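/- arXiv:1504.00660 — 3 statements merged into one kernel-verified Lean document; each statement's English description precedes it below -/
import Mathlib

section
/- Let q : [0,1] → ℝ be continuous with q(x) ≤ 0 on [0,1], and suppose q is monotone increasing on [0,x₀] for some fixed x₀ ∈ [0,1]. Set q₋ = min{q(x) : x ∈ [0,1]} and let θ(x,z) = φ(x,z)/z be the rescaled Prüfer angle of the solution y(x,z). Then for every z ≥ √(−2q₋), the derivative of θ(x₀,z) with respect to z satisfies ∂θ/∂z (x₀,z) ≤ 0. -/
open Real Set Filter Topology

namespace PruferAngle

/-- The continuous branch of `arctan (κ tan φ)` that vanishes at `φ = 0`. -/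
noncomputable def angle (κ φ : ℝ) : ℝ :=
  φ + arctan ((κ - 1) * (sin φ * cos φ) / (1 + (κ - 1) * sin φ ^ 2))

/-- The value of `φ - z ∂φ/∂z` for the constant potential `q = -(κ ^ 2 - 1) z ^ 2`,
as a function of the Prüfer angle. -/
noncomputable def constDefect (κ φ : ℝ) : ℝ :=
  φ - (cos φ ^ 2 / κ ^ 3 + sin φ ^ 2 / κ) * angle κ φ - (1 - 1 / κ ^ 2) * (sin φ * cos φ)

lemma angle_denom_pos {κ : ℝ} (hκ : 1 ≤ κ) (φ : ℝ) : 0 < 1 + (κ - 1) * sin φ ^ 2 := by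
  have := mul_nonneg (sub_nonneg.2 hκ) (sq_nonneg (sin φ))
  linarith

lemma cos_sq_add_mul_sin_sq_pos {κ : ℝ} (hκ : 1 ≤ κ) (φ : ℝ) :
    0 < cos φ ^ 2 + κ ^ 2 * sin φ ^ 2 := by
  have : 0 ≤ (κ ^ 2 - 1) * sin φ ^ 2 := mul_nonneg (by nlinarith) (sq_nonneg _)
  nlinarith [sin_sq_add_cos_sq φ]

lemma hasDerivAt_angle {κ : ℝ} (hκ : 1 ≤ κ) (φ : ℝ) :
    HasDerivAt (angle κ) (κ / (cos φ ^ 2 + κ ^ 2 * sin φ ^ 2)) φ := by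
  have h1 := angle_denom_pos hκ φ
  have h2 := cos_sq_add_mul_sin_sq_pos hκ φ
  have hs := hasDerivAt_sin φ
  have hc := hasDerivAt_cos φ
  have key := (hasDerivAt_id φ).add
    (((hs.mul hc).const_mul (κ - 1)).div (((hs.pow 2).const_mul (κ - 1)).const_add 1) h1.ne').arctan
  refine key.congr_deriv ?_
  have hsc := sin_sq_add_cos_sq φ
  simp only [Pi.mul_apply, Pi.pow_apply, Pi.div_apply]
  clear key hs hc
  generalize sin φ = s at *
  generalize cos φ = c at *
  have h3 : (1 + (κ - 1) * s ^ 2) ^ 2 + ((κ - 1) * (s * c)) ^ 2 = c ^ 2 + κ ^ 2 * s ^ 2 := by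
    have : c ^ 2 = 1 - s ^ 2 := by linarith
    rw [mul_pow, mul_pow, this]; ring
  have h4 : 1 + ((κ - 1) * (s * c) / (1 + (κ - 1) * s ^ 2)) ^ 2
      = (c ^ 2 + κ ^ 2 * s ^ 2) / (1 + (κ - 1) * s ^ 2) ^ 2 := by
    rw [← h3]; field_simp
  rw [h4]
  clear h3 h4
  obtain ⟨u, hu⟩ : ∃ u, u = 1 + (κ - 1) * s ^ 2 := ⟨_, rfl⟩
  rw [← hu] at h1 ⊢
  field_simp
  push_cast
  simp only [pow_one]
  grind

lemma hasDerivAt_angle_left {κ : ℝ} (hκ : 1 ≤ κ) (φ : ℝ) :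
    HasDerivAt (fun k => angle k φ) (sin φ * cos φ / (cos φ ^ 2 + κ ^ 2 * sin φ ^ 2)) κ := by
  have h1 := angle_denom_pos hκ φ
  have h2 := cos_sq_add_mul_sin_sq_pos hκ φ
  have hk := (hasDerivAt_id κ).sub_const 1
  have key := ((hk.mul_const (sin φ * cos φ)).div
    ((hk.mul_const (sin φ ^ 2)).const_add 1) h1.ne').arctan.const_add φ
  refine key.congr_deriv ?_
  have hsc := sin_sq_add_cos_sq φ
  simp only [id, Pi.div_apply]
  set s := sin φ
  set c := cos φ
  have hc2 : c ^ 2 = 1 - s ^ 2 := by linarith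
  have h3 : (1 + (κ - 1) * s ^ 2) ^ 2 + ((κ - 1) * (s * c)) ^ 2 = c ^ 2 + κ ^ 2 * s ^ 2 := by
    rw [mul_pow, mul_pow, hc2]; ring
  have h4 : 1 + ((κ - 1) * (s * c) / (1 + (κ - 1) * s ^ 2)) ^ 2
      = (c ^ 2 + κ ^ 2 * s ^ 2) / (1 + (κ - 1) * s ^ 2) ^ 2 := by
    rw [← h3]; field_simp
  rw [h4]
  clear h3 h4 key
  obtain ⟨u, hu⟩ : ∃ u, u = 1 + (κ - 1) * s ^ 2 := ⟨_, rfl⟩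
  rw [← hu] at h1 ⊢
  field_simp
  rw [hu]
  ring

lemma angle_zero (κ : ℝ) : angle κ 0 = 0 := by simp [angle]

/-- A form of the Cusa–Huygens inequality. -/
lemma three_mul_sin_mul_cos_le {κ φ : ℝ} (hκ : 1 ≤ κ) (hφ : 0 ≤ φ) :
    3 * κ * (sin φ * cos φ) ≤ angle κ φ * (3 * cos φ ^ 2 + κ ^ 2 * sin φ ^ 2) := by
  have hden : ∀ u, 0 < 3 * cos u ^ 2 + κ ^ 2 * sin u ^ 2 := fun u => by
    have := cos_sq_add_mul_sin_sq_pos hκ u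
    nlinarith [sq_nonneg (cos u)]
  have hderiv : ∀ u, HasDerivAt
      (fun v => angle κ v - 3 * κ * (sin v * cos v) / (3 * cos v ^ 2 + κ ^ 2 * sin v ^ 2))
      (4 * κ ^ 5 * sin u ^ 4 /
        ((cos u ^ 2 + κ ^ 2 * sin u ^ 2) * (3 * cos u ^ 2 + κ ^ 2 * sin u ^ 2) ^ 2)) u := by
    intro u
    have h2 := cos_sq_add_mul_sin_sq_pos hκ u
    have hs := hasDerivAt_sin u
    have hc := hasDerivAt_cos u
    refine ((hasDerivAt_angle hκ u).sub (((hs.mul hc).const_mul (3 * κ)).div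
      (((hc.pow 2).const_mul 3).add ((hs.pow 2).const_mul (κ ^ 2))) (hden u).ne')).congr_deriv ?_
    have hsc := sin_sq_add_cos_sq u
    have h3 := hden u
    simp only [Pi.mul_apply, Pi.pow_apply, Pi.add_apply]
    clear hden hs hc
    generalize sin u = s at *
    generalize cos u = c at *
    obtain ⟨w, hw⟩ : ∃ w, w = 3 * c ^ 2 + κ ^ 2 * s ^ 2 := ⟨_, rfl⟩
    rw [← hw] at h3 ⊢
    field_simp
    push_cast
    simp only [pow_one]
    grind
  have hmono : MonotoneOn
      (fun v => angle κ v - 3 * κ * (sin v * cos v) / (3 * cos v ^ 2 + κ ^ 2 * sin v ^ 2)) univ :=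
    monotoneOn_of_deriv_nonneg convex_univ
      (fun u _ => (hderiv u).continuousAt.continuousWithinAt)
      (fun u _ => (hderiv u).differentiableAt.differentiableWithinAt)
      (fun u _ => by
        rw [(hderiv u).deriv]
        have := cos_sq_add_mul_sin_sq_pos hκ u
        have := hden u
        have : 0 ≤ κ := by linarith
        positivity)
  have := hmono (mem_univ 0) (mem_univ φ) hφ
  simp only [angle_zero, sin_zero, zero_mul, mul_zero, zero_div, sub_zero] at this
  rwa [sub_nonneg, div_le_iff₀ (hden φ)] at this

lemma constDefect_zero_right (κ : ℝ) : constDefect κ 0 = 0 := by simp [constDefect, angle_zero]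

lemma constDefect_one_left (φ : ℝ) : constDefect 1 φ = 0 := by
  simp [constDefect, angle]

lemma monotoneOn_constDefect {φ : ℝ} (hφ : 0 ≤ φ) :
    MonotoneOn (fun κ => constDefect κ φ) (Ici 1) := by
  have hderiv : ∀ κ : ℝ, 1 ≤ κ → HasDerivAt (fun k => constDefect k φ)
      ((angle κ φ * (3 * cos φ ^ 2 + κ ^ 2 * sin φ ^ 2) - 3 * κ * (sin φ * cos φ)) / κ ^ 4) κ := by
    intro κ hκ
    have h0 : κ ≠ 0 := by linarith
    have h2 := cos_sq_add_mul_sin_sq_pos hκ φ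
    have hk := hasDerivAt_id κ
    refine ((((((hasDerivAt_const κ (cos φ ^ 2)).div (hk.pow 3) (pow_ne_zero 3 h0)).add
      ((hasDerivAt_const κ (sin φ ^ 2)).div hk h0)).mul (hasDerivAt_angle_left hκ φ)).const_sub φ).sub
      ((((hasDerivAt_const κ 1).div (hk.pow 2) (pow_ne_zero 2 h0)).const_sub 1).mul_const
        (sin φ * cos φ))).congr_deriv ?_
    simp only [Pi.add_apply, Pi.div_apply, Pi.pow_apply, id]
    field_simp
    push_cast
    ring
  refine monotoneOn_of_deriv_nonneg (convex_Ici 1)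
      (fun u hu => (hderiv u hu).continuousAt.continuousWithinAt)
      (fun u hu => (hderiv u (interior_subset hu)).differentiableAt.differentiableWithinAt)
      (fun u hu => ?_)
  have hu : 1 ≤ u := interior_subset hu
  rw [(hderiv u hu).deriv]
  exact div_nonneg (sub_nonneg.2 (three_mul_sin_mul_cos_le hu hφ)) (by positivity)

lemma constDefect_nonneg {κ φ : ℝ} (hκ : 1 ≤ κ) (hφ : 0 ≤ φ) : 0 ≤ constDefect κ φ := by
  have := monotoneOn_constDefect hφ (mem_Ici.2 le_rfl) (mem_Ici.2 hκ) hκ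
  simpa [constDefect_one_left] using this

lemma hasDerivAt_constDefect {κ : ℝ} (hκ : 1 ≤ κ) (φ : ℝ) :
    HasDerivAt (constDefect κ)
      ((κ ^ 2 - 1) * (2 * sin φ ^ 2 - 2 * sin φ * cos φ * (φ - constDefect κ φ)) /
        (1 + (κ ^ 2 - 1) * sin φ ^ 2)) φ := by
  have h0 : κ ≠ 0 := by linarith
  have h2 := cos_sq_add_mul_sin_sq_pos hκ φ
  have hs := hasDerivAt_sin φ
  have hc := hasDerivAt_cos φ
  refine (((hasDerivAt_id φ).sub ((((hc.pow 2).div_const (κ ^ 3)).add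
    ((hs.pow 2).div_const κ)).mul (hasDerivAt_angle hκ φ))).sub
    ((hs.mul hc).const_mul (1 - 1 / κ ^ 2))).congr_deriv ?_
  have hsc := sin_sq_add_cos_sq φ
  simp only [Pi.add_apply, Pi.pow_apply, constDefect]
  set s := sin φ
  set c := cos φ
  have hc2 : c ^ 2 = 1 - s ^ 2 := by linarith
  have h3 : 1 + (κ ^ 2 - 1) * s ^ 2 = c ^ 2 + κ ^ 2 * s ^ 2 := by rw [hc2]; ring
  rw [h3]
  set A := angle κ φ
  field_simp
  push_cast
  simp only [pow_one]
  grind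

lemma continuousOn_constDefect :
    ContinuousOn (fun v : ℝ × ℝ => constDefect v.1 v.2) {v | 1 ≤ v.1} := by
  have h1 : ∀ v ∈ {v : ℝ × ℝ | 1 ≤ v.1}, v.1 ≠ 0 := fun v hv => by
    have : (1 : ℝ) ≤ v.1 := hv
    linarith
  have h2 : ∀ v ∈ {v : ℝ × ℝ | 1 ≤ v.1}, v.1 ^ 2 ≠ 0 := fun v hv => pow_ne_zero 2 (h1 v hv)
  have h3 : ∀ v ∈ {v : ℝ × ℝ | 1 ≤ v.1}, v.1 ^ 3 ≠ 0 := fun v hv => pow_ne_zero 3 (h1 v hv)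
  have h4 : ∀ v ∈ {v : ℝ × ℝ | 1 ≤ v.1}, 1 + (v.1 - 1) * sin v.2 ^ 2 ≠ 0 :=
    fun v hv => (angle_denom_pos hv v.2).ne'
  unfold constDefect angle
  fun_prop (disch := assumption)

lemma abs_sin_sq_sub_sin_sq_le (a b : ℝ) : |sin b ^ 2 - sin a ^ 2| ≤ |b - a| := by
  have h : sin b ^ 2 - sin a ^ 2 = sin (b + a) * sin (b - a) := by
    rw [sin_add, sin_sub]
    linear_combination sin a ^ 2 * sin_sq_add_cos_sq b - sin b ^ 2 * sin_sq_add_cos_sq a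
  rw [h, abs_mul]
  exact (mul_le_of_le_one_left (abs_nonneg _) (abs_sin_le_one _)).trans abs_sin_le_abs

lemma abs_sin_sq_sub_linear_le (a b : ℝ) :
    |sin b ^ 2 - sin a ^ 2 - 2 * sin a * cos a * (b - a)| ≤ 2 * |b - a| ^ 2 := by
  have hd : ∀ u ∈ uIcc a b, HasDerivWithinAt
      (fun v => sin v ^ 2 - 2 * sin a * cos a * v) (sin (2 * u) - sin (2 * a)) (uIcc a b) u := by
    intro u _
    refine (((hasDerivAt_sin u).pow 2).sub
      ((hasDerivAt_id u).const_mul (2 * sin a * cos a))).hasDerivWithinAt.congr_deriv ?_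
    rw [sin_two_mul, sin_two_mul]
    push_cast
    simp
  have hb : ∀ u ∈ uIcc a b, ‖sin (2 * u) - sin (2 * a)‖ ≤ 2 * |b - a| := by
    intro u hu
    rw [Real.norm_eq_abs]
    have h1 : |sin (2 * u) - sin (2 * a)| ≤ |2 * u - 2 * a| := abs_sin_sub_sin_le _ _
    rw [← mul_sub, abs_mul, abs_two] at h1
    have := abs_sub_left_of_mem_uIcc hu
    linarith
  have := (convex_uIcc a b).norm_image_sub_le_of_norm_hasDerivWithin_le hd hb
    left_mem_uIcc right_mem_uIcc
  rw [Real.norm_eq_abs, Real.norm_eq_abs] at this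
  calc _ = |sin b ^ 2 - 2 * sin a * cos a * b - (sin a ^ 2 - 2 * sin a * cos a * a)| := by
        congr 1; ring
    _ ≤ _ := this
    _ = _ := by ring

/-- Lipschitz dependence of the Prüfer angle on the spectral parameter. -/
lemma abs_angle_sub_le {q φ₁ φ₂ : ℝ → ℝ} {P z h : ℝ} (hz : 0 < z) (hh : 0 < h)
    (hq : ∀ x ∈ Icc (0 : ℝ) 1, |q x| ≤ P) (h₁0 : φ₁ 0 = 0) (h₂0 : φ₂ 0 = 0)
    (h₁ : ∀ x ∈ Icc (0 : ℝ) 1, HasDerivAt φ₁ (z - q x / z * sin (φ₁ x) ^ 2) x)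
    (h₂ : ∀ x ∈ Icc (0 : ℝ) 1, HasDerivAt φ₂ (z + h - q x / (z + h) * sin (φ₂ x) ^ 2) x) :
    ∀ x ∈ Icc (0 : ℝ) 1,
      |φ₂ x - φ₁ x| ≤ (1 + P / z ^ 2) * exp (P / z + 1) * h := by
  have hP : 0 ≤ P := (abs_nonneg _).trans (hq 0 (by simp))
  have hzh : 0 < z + h := by positivity
  have hd : ∀ x ∈ Icc (0 : ℝ) 1, HasDerivAt (fun t => φ₂ t - φ₁ t)
      ((z + h - q x / (z + h) * sin (φ₂ x) ^ 2) - (z - q x / z * sin (φ₁ x) ^ 2)) x :=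
    fun x hx => (h₂ x hx).sub (h₁ x hx)
  have key := norm_le_gronwallBound_of_norm_deriv_right_le (δ := 0) (K := P / z + 1)
    (ε := (1 + P / z ^ 2) * h)
    (fun x hx => (hd x hx).continuousAt.continuousWithinAt)
    (fun x hx => (hd x (Ico_subset_Icc_self hx)).hasDerivWithinAt) (by simp [h₁0, h₂0])
    (fun x hx => by
      rw [Real.norm_eq_abs, Real.norm_eq_abs]
      have hqx := hq x (Ico_subset_Icc_self hx)
      have e : (z + h - q x / (z + h) * sin (φ₂ x) ^ 2) - (z - q x / z * sin (φ₁ x) ^ 2)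
          = h + -(q x / (z + h) * (sin (φ₂ x) ^ 2 - sin (φ₁ x) ^ 2))
            + q x * h / (z * (z + h)) * sin (φ₁ x) ^ 2 := by
        field_simp
        ring
      have b1 : |-(q x / (z + h) * (sin (φ₂ x) ^ 2 - sin (φ₁ x) ^ 2))|
          ≤ P / z * |φ₂ x - φ₁ x| := by
        rw [abs_neg, abs_mul, abs_div, abs_of_pos hzh]
        refine mul_le_mul ?_ (abs_sin_sq_sub_sin_sq_le _ _) (abs_nonneg _) (by positivity)
        gcongr
        linarith
      have b2 : |q x * h / (z * (z + h)) * sin (φ₁ x) ^ 2| ≤ P * h / z ^ 2 * 1 := by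
        rw [abs_mul, abs_div, abs_mul, abs_of_pos hh, abs_of_pos (mul_pos hz hzh),
          abs_of_nonneg (sq_nonneg (sin (φ₁ x)))]
        gcongr
        · nlinarith
        · exact sin_sq_le_one _
      rw [e]
      calc _ ≤ h + P / z * |φ₂ x - φ₁ x| + P * h / z ^ 2 * 1 := by
            refine (abs_add_le _ _).trans (add_le_add ((abs_add_le _ _).trans ?_) b2)
            exact add_le_add (abs_of_pos hh).le b1
        _ ≤ _ := by
            have : P * h / z ^ 2 * 1 = P / z ^ 2 * h := by ring
            rw [this]
            linarith [abs_nonneg (φ₂ x - φ₁ x)])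
  intro x hx
  have hK : 1 ≤ P / z + 1 := by
    have : 0 ≤ P / z := by positivity
    linarith
  refine (key x hx).trans ?_
  rw [gronwallBound_of_K_ne_0 (by positivity)]
  have h3 : exp ((P / z + 1) * (x - 0)) ≤ exp (P / z + 1) :=
    exp_le_exp.2 (by nlinarith [hx.2])
  have h4 : (1 + P / z ^ 2) * h / (P / z + 1) ≤ (1 + P / z ^ 2) * h :=
    div_le_self (by positivity) hK
  have h5 : 0 ≤ (1 + P / z ^ 2) * h / (P / z + 1) := by positivity
  calc _ ≤ 0 * exp ((P / z + 1) * (x - 0))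
        + (1 + P / z ^ 2) * h / (P / z + 1) * exp (P / z + 1) :=
          add_le_add_right (mul_le_mul_of_nonneg_left (by linarith) h5) _
    _ = (1 + P / z ^ 2) * h / (P / z + 1) * exp (P / z + 1) := by ring
    _ ≤ (1 + P / z ^ 2) * h * exp (P / z + 1) :=
          mul_le_mul_of_nonneg_right h4 (exp_pos _).le
    _ = _ := by ring

/-- The difference quotient of the angle in the spectral parameter satisfies the linearized
Prüfer equation up to an error of first order. -/
lemma linearized_sub_deriv_le {p P z h L a b : ℝ} (hz : 0 < z) (hh : 0 < h)
    (hp : |p| ≤ P) (hab : |b - a| ≤ L * h) :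
    -p / z * (2 * sin a ^ 2 - 2 * sin a * cos a * (z * (b - a) / h)) -
        ((z - p / z * sin a ^ 2) -
          z * ((z + h - p / (z + h) * sin b ^ 2) - (z - p / z * sin a ^ 2)) / h)
      ≤ (P / z ^ 2 + 2 * P * L ^ 2 + P * L / z) * h := by
  have hP : 0 ≤ P := (abs_nonneg _).trans hp
  have hzh : 0 < z + h := by positivity
  have e : -p / z * (2 * sin a ^ 2 - 2 * sin a * cos a * (z * (b - a) / h)) -
        ((z - p / z * sin a ^ 2) -
          z * ((z + h - p / (z + h) * sin b ^ 2) - (z - p / z * sin a ^ 2)) / h)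
      = -p * h / (z * (z + h)) * sin a ^ 2
        + -p / h * (sin b ^ 2 - sin a ^ 2 - 2 * sin a * cos a * (b - a))
        + p / (z + h) * (sin b ^ 2 - sin a ^ 2) := by
    field_simp
    ring
  have b1 : |-p * h / (z * (z + h)) * sin a ^ 2| ≤ P * h / z ^ 2 * 1 := by
    rw [abs_mul, abs_div, abs_mul, abs_neg, abs_of_pos hh, abs_of_pos (mul_pos hz hzh),
      abs_of_nonneg (sq_nonneg (sin a))]
    gcongr
    · nlinarith
    · exact sin_sq_le_one _
  have b2 : |-p / h * (sin b ^ 2 - sin a ^ 2 - 2 * sin a * cos a * (b - a))|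
      ≤ P / h * (2 * (L * h) ^ 2) := by
    rw [abs_mul, abs_div, abs_neg, abs_of_pos hh]
    gcongr
    exact (abs_sin_sq_sub_linear_le a b).trans (by gcongr)
  have b3 : |p / (z + h) * (sin b ^ 2 - sin a ^ 2)| ≤ P / z * (L * h) := by
    rw [abs_mul, abs_div, abs_of_pos hzh]
    gcongr
    · linarith
    · exact (abs_sin_sq_sub_sin_sq_le a b).trans hab
  have b4 : P / h * (2 * (L * h) ^ 2) = 2 * P * L ^ 2 * h := by field_simp
  have b5 : (P / z ^ 2 + 2 * P * L ^ 2 + P * L / z) * h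
      = P * h / z ^ 2 * 1 + 2 * P * L ^ 2 * h + P / z * (L * h) := by ring
  rw [e, b5, ← b4]
  exact add_le_add (add_le_add ((le_abs_self _).trans b1) ((le_abs_self _).trans b2))
    ((le_abs_self _).trans b3)

/-- Comparison of a supersolution of the linearized Prüfer equation with `constDefect`. -/
lemma constDefect_sub_le {q φ D D' : ℝ → ℝ} {P z ε x₀ : ℝ} (hz : 0 < z) (hε : 0 < ε)
    (hx₀ : 0 ≤ x₀) (hq_cont : ContinuousOn q (Icc 0 x₀)) (hq_nonpos : ∀ x ∈ Icc 0 x₀, q x ≤ 0)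
    (hq_mono : MonotoneOn q (Icc 0 x₀)) (hq : ∀ x ∈ Icc 0 x₀, |q x| ≤ P)
    (hφ0 : φ 0 = 0)
    (hφ : ∀ x ∈ Icc 0 x₀, HasDerivAt φ (z - q x / z * sin (φ x) ^ 2) x)
    (hφ_nonneg : ∀ x ∈ Icc 0 x₀, 0 ≤ φ x)
    (hD0 : D 0 = 0) (hD : ∀ x ∈ Icc 0 x₀, HasDerivAt D (D' x) x)
    (hD' : ∀ x ∈ Icc 0 x₀,
      -q x / z * (2 * sin (φ x) ^ 2 - 2 * sin (φ x) * cos (φ x) * (φ x - D x)) - D' x ≤ ε) :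
    constDefect √(1 - q x₀ / z ^ 2) (φ x₀) - D x₀ ≤ ε * exp ((P / z + 2) * x₀) := by
  have hκ : ∀ x ∈ Icc 0 x₀, 1 ≤ √(1 - q x / z ^ 2) := fun x hx => by
    rw [one_le_sqrt]
    have := div_nonpos_of_nonpos_of_nonneg (hq_nonpos x hx) (sq_nonneg z)
    linarith
  have hφ_cont : ContinuousOn φ (Icc 0 x₀) :=
    fun x hx => (hφ x hx).continuousAt.continuousWithinAt
  have hD_cont : ContinuousOn D (Icc 0 x₀) :=
    fun x hx => (hD x hx).continuousAt.continuousWithinAt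
  have hκ_cont : ContinuousOn (fun x => √(1 - q x / z ^ 2)) (Icc 0 x₀) := by
    fun_prop (disch := positivity)
  have hcont : ContinuousOn
      (fun x => constDefect √(1 - q x / z ^ 2) (φ x) - D x) (Icc 0 x₀) :=
    (continuousOn_constDefect.comp (hκ_cont.prodMk hφ_cont) hκ).sub hD_cont
  have hfrozen : ∀ x ∈ Icc 0 x₀, HasDerivAt
      (fun y => constDefect √(1 - q x / z ^ 2) (φ y) - D y)
      (-q x / z * (2 * sin (φ x) ^ 2 - 2 * sin (φ x) * cos (φ x) *
        (φ x - constDefect √(1 - q x / z ^ 2) (φ x))) - D' x) x := by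
    intro x hx
    refine (((hasDerivAt_constDefect (hκ x hx) (φ x)).comp x (hφ x hx)).sub
      (hD x hx)).congr_deriv ?_
    have hs : √(1 - q x / z ^ 2) ^ 2 - 1 = -q x / z ^ 2 := by
      rw [sq_sqrt (by linarith [one_le_sqrt.1 (hκ x hx)])]
      ring
    have hden : 0 < 1 + (√(1 - q x / z ^ 2) ^ 2 - 1) * sin (φ x) ^ 2 := by
      have := mul_nonneg (by nlinarith [hκ x hx] : 0 ≤ √(1 - q x / z ^ 2) ^ 2 - 1)
        (sq_nonneg (sin (φ x)))
      linarith
    have hz' : z - q x / z * sin (φ x) ^ 2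
        = z * (1 + (√(1 - q x / z ^ 2) ^ 2 - 1) * sin (φ x) ^ 2) := by
      rw [hs]; field_simp; ring
    rw [hz', div_mul_eq_mul_div, mul_left_comm, ← mul_assoc, mul_div_cancel_right₀ _ hden.ne', hs]
    field_simp
  have hB : ∀ x, HasDerivAt (fun x => ε * exp ((P / z + 2) * x))
      (ε * (exp ((P / z + 2) * x) * (P / z + 2))) x := fun x => by
    simpa using (((hasDerivAt_id x).const_mul (P / z + 2)).exp).const_mul ε
  refine image_le_of_liminf_slope_right_lt_deriv_boundary' hcont
    (f' := fun x => -q x / z * (2 * sin (φ x) ^ 2 - 2 * sin (φ x) * cos (φ x) *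
        (φ x - constDefect √(1 - q x / z ^ 2) (φ x))) - D' x) (fun x hx r hr => ?_)
    (B := fun x => ε * exp ((P / z + 2) * x)) ?_ ?_ (fun x _ => (hB x).hasDerivWithinAt)
    (fun x hx hfx => ?_) (right_mem_Icc.2 hx₀)
  · have hxI := Ico_subset_Icc_self hx
    have h1 := ((hasDerivAt_iff_tendsto_slope.1 (hfrozen x hxI)).mono_left
      (nhdsWithin_mono x fun y (hy : x < y) => hy.ne')).eventually (gt_mem_nhds hr)
    refine Eventually.frequently ?_
    filter_upwards [h1, Ioo_mem_nhdsGT hx.2] with y hy hyx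
    refine lt_of_le_of_lt ?_ hy
    have hyI : y ∈ Icc 0 x₀ := ⟨hx.1.trans hyx.1.le, hyx.2.le⟩
    rw [slope_def_field, slope_def_field]
    have hxy : 0 < y - x := sub_pos.2 hyx.1
    have := monotoneOn_constDefect (hφ_nonneg y hyI) (hκ y hyI) (hκ x hxI)
      (by gcongr; exact hq_mono hxI hyI hyx.1.le)
    simp only at this
    gcongr
  · simp [hφ0, hD0, constDefect_zero_right, hε.le]
  · exact fun x _ => (hB x).continuousAt.continuousWithinAt
  · have hxI := Ico_subset_Icc_self hx
    have h1 := hD' x hxI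
    set B := ε * exp ((P / z + 2) * x) with hBdef
    have hBε : ε ≤ B := by
      have hP : 0 ≤ P := (abs_nonneg _).trans (hq x hxI)
      have h2 : 0 ≤ (P / z + 2) * x := mul_nonneg (by positivity) hx.1
      exact le_mul_of_one_le_right hε.le (one_le_exp h2)
    have h2 : |-q x / z * (2 * sin (φ x) * cos (φ x)) * B| ≤ P / z * 1 * B := by
      rw [abs_mul, abs_mul, abs_div, abs_neg, abs_of_pos hz, abs_of_pos (hε.trans_le hBε),
        ← sin_two_mul]
      have hP : 0 ≤ P := (abs_nonneg _).trans (hq x hxI)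
      gcongr
      · exact hq x hxI
      · exact abs_sin_le_one _
    have h3 := (le_abs_self _).trans h2
    have h4 : -q x / z * (2 * sin (φ x) ^ 2 - 2 * sin (φ x) * cos (φ x) *
          (φ x - constDefect √(1 - q x / z ^ 2) (φ x))) - D' x
        = -q x / z * (2 * sin (φ x) ^ 2 - 2 * sin (φ x) * cos (φ x) * (φ x - D x)) - D' x
          + -q x / z * (2 * sin (φ x) * cos (φ x)) * B := by
      rw [← hfx]; ring
    have h5 : ε * (exp ((P / z + 2) * x) * (P / z + 2)) = P / z * 1 * B + 2 * B := by
      rw [hBdef]; ring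
    rw [h4, h5]
    linarith

end PruferAngle


/-!
**Statement 0.**  Let `q : [0,1] → ℝ` be continuous with `q ≤ 0` on `[0,1]`, and suppose `q`
is monotone increasing on `[0,x₀]` for some fixed `x₀ ∈ [0,1]`.  Set
`q₋ = min {q x : x ∈ [0,1]}` and let `θ(x,z) = φ(x,z)/z` be the rescaled Prüfer angle of the
solution `y(x,z)` of `−y'' + q y = z² y`, `y(0) = 0`, `y'(0) = 1`.  (The Prüfer angle `φ`
satisfies `φ(0,z) = 0` and `∂φ/∂x = z − (q/z) sin² φ` for every `z > 0`.)  Then for every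
`z ≥ √(−2 q₋)` (with `z > 0`), the derivative of `θ(x₀, ·)` with respect to `z` satisfies
`∂θ/∂z (x₀,z) ≤ 0`.
-/
theorem prufer_theta_deriv_nonpos
    (q : ℝ → ℝ) (x₀ : ℝ) (hx₀ : x₀ ∈ Set.Icc (0 : ℝ) 1)
    (hq_cont : ContinuousOn q (Set.Icc 0 1))
    (hq_nonpos : ∀ x ∈ Set.Icc (0 : ℝ) 1, q x ≤ 0)
    (hq_mono : MonotoneOn q (Set.Icc 0 x₀))
    (qmin : ℝ) (hqmin : IsLeast (q '' Set.Icc 0 1) qmin)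
    -- the Prüfer angle `φ x z` of the solution `y(·,z)`:
    (φ : ℝ → ℝ → ℝ)
    (hφ0 : ∀ z : ℝ, 0 < z → φ 0 z = 0)
    (hφ' : ∀ z : ℝ, 0 < z → ∀ x ∈ Set.Icc (0 : ℝ) 1,
      HasDerivAt (fun t => φ t z) (z - q x / z * Real.sin (φ x z) ^ 2) x) :
    ∀ z : ℝ, 0 < z → Real.sqrt (-2 * qmin) ≤ z →
      ∀ d : ℝ, HasDerivAt (fun w => φ x₀ w / w) d z → d ≤ 0 := by
  intro z hz _ d hd
  have hsub : Set.Icc 0 x₀ ⊆ Set.Icc (0 : ℝ) 1 := Set.Icc_subset_Icc_right hx₀.2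
  have hq_abs : ∀ x ∈ Set.Icc (0 : ℝ) 1, |q x| ≤ -qmin := fun x hx => by
    rw [abs_of_nonpos (hq_nonpos x hx)]
    exact neg_le_neg (hqmin.2 (Set.mem_image_of_mem q hx))
  set P := -qmin
  have hφ_nonneg : ∀ x ∈ Set.Icc (0 : ℝ) 1, 0 ≤ φ x z := by
    have hmono : MonotoneOn (fun t => φ t z) (Set.Icc 0 1) :=
      monotoneOn_of_hasDerivWithinAt_nonneg (convex_Icc 0 1)
        (fun x hx => (hφ' z hz x hx).continuousAt.continuousWithinAt)
        (fun x hx => (hφ' z hz x (interior_subset hx)).hasDerivWithinAt)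
        (fun x hx => by
          have := mul_nonpos_of_nonpos_of_nonneg
            (div_nonpos_of_nonpos_of_nonneg (hq_nonpos x (interior_subset hx)) hz.le)
            (sq_nonneg (Real.sin (φ x z)))
          linarith)
    intro x hx
    simpa [hφ0 z hz] using hmono (Set.left_mem_Icc.2 zero_le_one) hx hx.1
  obtain ⟨C, hC⟩ : ∃ C : ℝ, ∀ h : ℝ, 0 < h →
      -(φ x₀ z - z * (φ x₀ (z + h) - φ x₀ z) / h) ≤ C * h := by
    set L := (1 + P / z ^ 2) * Real.exp (P / z + 1)
    have hP : 0 ≤ P := (abs_nonneg _).trans (hq_abs 0 (by simp))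
    refine ⟨(P / z ^ 2 + 2 * P * L ^ 2 + P * L / z + 1) * Real.exp ((P / z + 2) * x₀),
      fun h hh => ?_⟩
    have hzh : 0 < z + h := by positivity
    have hL : ∀ x ∈ Set.Icc (0 : ℝ) 1, |φ x (z + h) - φ x z| ≤ L * h :=
      PruferAngle.abs_angle_sub_le (φ₁ := fun t => φ t z) (φ₂ := fun t => φ t (z + h)) hz hh
        hq_abs (hφ0 z hz) (hφ0 _ hzh) (hφ' z hz) (hφ' _ hzh)
    have key := PruferAngle.constDefect_sub_le (P := P)
      (ε := (P / z ^ 2 + 2 * P * L ^ 2 + P * L / z + 1) * h)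
      (D := fun t => φ t z - z * (φ t (z + h) - φ t z) / h) hz (by positivity) hx₀.1
      (hq_cont.mono hsub) (fun x hx => hq_nonpos x (hsub hx)) hq_mono
      (fun x hx => hq_abs x (hsub hx)) (hφ0 z hz) (fun x hx => hφ' z hz x (hsub hx))
      (fun x hx => hφ_nonneg x (hsub hx)) (by simp [hφ0 z hz, hφ0 _ hzh])
      (fun x hx => (hφ' z hz x (hsub hx)).sub
        ((((hφ' _ hzh x (hsub hx)).sub (hφ' z hz x (hsub hx))).const_mul z).div_const h))
      (fun x hx => by
        have := PruferAngle.linearized_sub_deriv_le hz hh (hq_abs x (hsub hx)) (hL x (hsub hx))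
        simp only [sub_sub_cancel]
        linarith)
    have hκ : 1 ≤ √(1 - q x₀ / z ^ 2) := by
      rw [Real.one_le_sqrt]
      have := div_nonpos_of_nonpos_of_nonneg (hq_nonpos x₀ hx₀) (sq_nonneg z)
      linarith
    have := PruferAngle.constDefect_nonneg hκ (hφ_nonneg x₀ hx₀)
    linarith
  have hφz : HasDerivAt (φ x₀) (φ x₀ z / z + z * d) z := by
    refine (((hasDerivAt_id z).mul hd).congr_deriv (by simp)).congr_of_eventuallyEq ?_
    filter_upwards [lt_mem_nhds hz] with w hw
    simp only [Pi.mul_apply, id]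
    field_simp
  have hlim : Tendsto (fun h => C * h + φ x₀ z - z * (h⁻¹ • (φ x₀ (z + h) - φ x₀ z)))
      (𝓝[>] 0) (𝓝 (C * 0 + φ x₀ z - z * (φ x₀ z / z + z * d))) :=
    (((tendsto_id.mono_left nhdsWithin_le_nhds).const_mul C).add_const _).sub
      (hφz.tendsto_slope_zero_right.const_mul z)
  have hnonneg : 0 ≤ C * 0 + φ x₀ z - z * (φ x₀ z / z + z * d) := ge_of_tendsto hlim (by
    filter_upwards [self_mem_nhdsWithin] with h hh
    have h1 := hC h hh
    have h2 : z * (h⁻¹ • (φ x₀ (z + h) - φ x₀ z)) = z * (φ x₀ (z + h) - φ x₀ z) / h := by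
      rw [smul_eq_mul]; ring
    rw [h2]
    linarith)
  have h3 : C * 0 + φ x₀ z - z * (φ x₀ z / z + z * d) = -(z ^ 2 * d) := by field_simp; ring
  rw [h3] at hnonneg
  exact nonpos_of_mul_nonpos_right (by linarith) (by positivity : 0 < z ^ 2)
end

section
/- Let q : [0,1] → ℝ be continuous with q(x) ≤ 0 on [0,1], and suppose q is monotone increasing on [0,x₀] for some fixed x₀ ∈ (0,1]. Set q₋ = min{q(x) : x ∈ [0,1]} and let θ(x,z) = φ(x,z)/z be the rescaled Prüfer angle of the solution y(x,z). If there exists z ≥ √(−2q₋) with ∂θ/∂z (x₀,z) = 0, then q ≡ 0 on (0,x₀]. -/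
open Set Filter Topology

theorem exists_hasDerivAt_of_continuousOn_Icc {f : ℝ → ℝ} {a b : ℝ} (hab : a ≤ b)
    (hf : ContinuousOn f (Icc a b)) :
    ∃ F : ℝ → ℝ, F a = 0 ∧ ∀ x ∈ Icc a b, HasDerivAt F (f x) x := by
  have hc : Continuous (IccExtend hab (domRestrict (Icc a b) f)) :=
    (continuousOn_iff_continuous_domRestrict.1 hf).Icc_extend'
  refine ⟨fun x => ∫ t in a..x, IccExtend hab (domRestrict (Icc a b) f) t, by simp, fun x hx => ?_⟩
  have h := intervalIntegral.integral_hasDerivAt_right (hc.intervalIntegrable a x)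
    (hc.stronglyMeasurableAtFilter _ _) hc.continuousAt
  rwa [IccExtend_of_mem hab _ hx] at h

/-- A transversal monotonicity principle: `x ↦ P x (A x)` increases when `A` decreases, `P` is
antitone in its second argument and `P` is stationary in its first one along the curve. -/
theorem le_of_antitone_of_hasDerivAt_zero {P : ℝ → ℝ → ℝ} {A : ℝ → ℝ} {u v : ℝ} (huv : u ≤ v)
    (hcont : ContinuousOn (fun x => P x (A x)) (Icc u v))
    (hanti : ∀ x ∈ Icc u v, ∀ y ∈ Icc u v, x ≤ y → P y (A x) ≤ P y (A y))
    (hderiv : ∀ x ∈ Icc u v, HasDerivAt (fun t => P t (A x)) 0 x) :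
    P u (A u) ≤ P v (A v) := by
  have h := image_le_of_liminf_slope_right_le_deriv_boundary (f := fun x => -P x (A x))
    (a := u) (b := v) (B := fun _ => -P u (A u)) (B' := fun _ => 0) hcont.neg le_rfl
    continuousOn_const (fun x _ => hasDerivWithinAt_const _ _ _) ?_ (right_mem_Icc.2 huv)
  · simpa using h
  intro x hx r hr
  have hx' : x ∈ Icc u v := Ico_subset_Icc_self hx
  have ht : Tendsto (slope (fun t => -P t (A x)) x) (𝓝[>] x) (𝓝 0) := by
    have h0 := (hderiv x hx').neg
    rw [neg_zero, hasDerivAt_iff_tendsto_slope] at h0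
    exact h0.mono_left (nhdsWithin_mono _ fun y hy => ne_of_gt hy)
  refine Eventually.frequently ?_
  filter_upwards [ht.eventually_lt_const hr, Ioo_mem_nhdsGT hx.2] with y hy hxy
  refine lt_of_le_of_lt ?_ hy
  have hle := hanti x hx' y ⟨hx.1.trans hxy.1.le, hxy.2.le⟩ hxy.1.le
  simp only [slope_def_field]
  have := sub_pos.2 hxy.1
  gcongr

theorem cos_sq_add_mul_sin_sq_pos {b : ℝ} (hb : 0 < b) (p : ℝ) :
    0 < Real.cos p ^ 2 + b * Real.sin p ^ 2 := by
  rcases eq_or_ne (Real.sin p) 0 with h | h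
  · have := Real.sin_sq_add_cos_sq p
    rw [h] at this ⊢
    nlinarith
  · positivity

/-- The continuous angle `ψ` with `tan ψ = a tan p`. -/
noncomputable def scaledAngle (p a : ℝ) : ℝ :=
  p + Real.arctan ((a - 1) * (Real.sin p * Real.cos p) / (Real.cos p ^ 2 + a * Real.sin p ^ 2))

theorem scaledAngle_zero (a : ℝ) : scaledAngle 0 a = 0 := by simp [scaledAngle]

theorem scaledAngle_one (p : ℝ) : scaledAngle p 1 = p := by simp [scaledAngle]

theorem HasDerivAt.arctan_div {f g : ℝ → ℝ} {f' g' x : ℝ} (hf : HasDerivAt f f' x)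
    (hg : HasDerivAt g g' x) (h : g x ≠ 0) :
    HasDerivAt (fun t => Real.arctan (f t / g t))
      ((f' * g x - f x * g') / (g x ^ 2 + f x ^ 2)) x := by
  refine (hf.div hg h).arctan.congr_deriv ?_
  have : g x ^ 2 + f x ^ 2 ≠ 0 := by positivity
  simp only [Pi.div_apply]
  field_simp

theorem cos_sq_add_sq_mul_sin_sq_eq (a p : ℝ) :
    (Real.cos p ^ 2 + a * Real.sin p ^ 2) ^ 2 + ((a - 1) * (Real.sin p * Real.cos p)) ^ 2
      = Real.cos p ^ 2 + a ^ 2 * Real.sin p ^ 2 := by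
  rw [Real.cos_sq', mul_pow, mul_pow, Real.cos_sq']; ring

theorem hasDerivAt_scaledAngle_left {a : ℝ} (ha : 0 < a) (p : ℝ) :
    HasDerivAt (fun p => scaledAngle p a)
      (a / (Real.cos p ^ 2 + a ^ 2 * Real.sin p ^ 2)) p := by
  have hd := (cos_sq_add_mul_sin_sq_pos (pow_pos ha 2) p).ne'
  have hs := Real.hasDerivAt_sin p
  have hc := Real.hasDerivAt_cos p
  refine ((hasDerivAt_id p).add (((hs.mul hc).const_mul (a - 1)).arctan_div
    ((hc.pow 2).add ((hs.pow 2).const_mul a))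
    (cos_sq_add_mul_sin_sq_pos ha p).ne')).congr_deriv ?_
  simp only [Pi.mul_apply, Pi.add_apply, Pi.pow_apply, cos_sq_add_sq_mul_sin_sq_eq]
  field_simp
  norm_num
  linear_combination (Real.cos p ^ 2 * (a - 1) - (a - 1) * a * Real.sin p ^ 2 + a)
    * Real.sin_sq_add_cos_sq p

theorem hasDerivAt_scaledAngle_right {a : ℝ} (ha : 0 < a) (p : ℝ) :
    HasDerivAt (fun a => scaledAngle p a)
      (Real.sin p * Real.cos p / (Real.cos p ^ 2 + a ^ 2 * Real.sin p ^ 2)) a := by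
  have hd := (cos_sq_add_mul_sin_sq_pos (pow_pos ha 2) p).ne'
  refine ((((hasDerivAt_id a).sub_const 1).mul_const (Real.sin p * Real.cos p)).arctan_div
    (((hasDerivAt_id a).mul_const (Real.sin p ^ 2)).const_add (Real.cos p ^ 2))
      (cos_sq_add_mul_sin_sq_pos ha p).ne').const_add p |>.congr_deriv ?_
  simp only [id, cos_sq_add_sq_mul_sin_sq_eq]
  rw [div_left_inj' hd]
  linear_combination (Real.sin p * Real.cos p) * Real.sin_sq_add_cos_sq p

/-- A scaled form of Cusa's inequality `3 sin u < u (2 + cos u)`. -/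
theorem three_mul_sin_mul_cos_lt {a p : ℝ} (ha : 0 < a) (hp : 0 < p) :
    3 * a * (Real.sin p * Real.cos p)
      < (3 * Real.cos p ^ 2 + a ^ 2 * Real.sin p ^ 2) * scaledAngle p a := by
  have hden (t : ℝ) : 0 < 3 * Real.cos t ^ 2 + a ^ 2 * Real.sin t ^ 2 := by
    have := cos_sq_add_mul_sin_sq_pos (pow_pos ha 2) t
    nlinarith [sq_nonneg (Real.cos t)]
  let f : ℝ → ℝ := fun t => scaledAngle t a
    - 3 * a * (Real.sin t * Real.cos t) / (3 * Real.cos t ^ 2 + a ^ 2 * Real.sin t ^ 2)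
  have hf (t : ℝ) : HasDerivAt f (4 * a ^ 5 * Real.sin t ^ 4
      / ((Real.cos t ^ 2 + a ^ 2 * Real.sin t ^ 2)
        * (3 * Real.cos t ^ 2 + a ^ 2 * Real.sin t ^ 2) ^ 2)) t := by
    have hs := Real.hasDerivAt_sin t
    have hc := Real.hasDerivAt_cos t
    have hd := (cos_sq_add_mul_sin_sq_pos (pow_pos ha 2) t).ne'
    have hd3 := (hden t).ne'
    refine ((hasDerivAt_scaledAngle_left ha t).sub (((hs.mul hc).const_mul (3 * a)).div
      (((hc.pow 2).const_mul 3).add ((hs.pow 2).const_mul (a ^ 2))) hd3)).congr_deriv ?_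
    simp only [Pi.mul_apply, Pi.add_apply, Pi.pow_apply]
    rw [div_sub_div _ _ hd (pow_ne_zero 2 hd3), div_left_inj' (mul_ne_zero hd (pow_ne_zero 2 hd3))]
    norm_num
    rw [show Real.sin t ^ 4 = (Real.sin t ^ 2) ^ 2 by ring, Real.sin_sq]
    linear_combination 3 * a * (Real.cos t ^ 2 + a ^ 2 * (1 - Real.cos t ^ 2))
      * (3 * Real.cos t ^ 2 + a ^ 2 * (1 - Real.cos t ^ 2) + Real.cos t ^ 2 * (2 * a ^ 2 - 6))
      * Real.sin_sq t
  have hmono : Monotone f := monotone_of_deriv_nonneg (fun t => (hf t).differentiableAt) fun t => by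
    rw [(hf t).deriv]
    have := cos_sq_add_mul_sin_sq_pos (pow_pos ha 2) t
    have := hden t
    positivity
  have hstrict : StrictMonoOn f (Icc 0 1) := by
    refine strictMonoOn_of_deriv_pos (convex_Icc 0 1)
      (fun t _ => (hf t).continuousAt.continuousWithinAt) fun t ht => ?_
    rw [interior_Icc] at ht
    rw [(hf t).deriv]
    have := Real.sin_pos_of_pos_of_lt_pi ht.1 (ht.2.trans (by linarith [Real.pi_gt_three]))
    have := cos_sq_add_mul_sin_sq_pos (pow_pos ha 2) t
    have := hden t
    positivity
  have hlt : f 0 < f p := lt_of_lt_of_le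
    (hstrict (by simp) ⟨(lt_min hp one_pos).le, min_le_right _ _⟩ (lt_min hp one_pos))
    (hmono (min_le_left p 1))
  have h0 : f 0 = 0 := by simp [f, scaledAngle_zero]
  rw [h0, sub_pos, div_lt_iff₀ (hden p)] at hlt
  linarith

/-- The phase function `N(p, a)` whose value `r² N(φ, a)` is the integral of `r² (1 - κ sin² φ)`
when the potential is frozen at `a² = 1 + κ`. -/
noncomputable def frozenPhase (p a : ℝ) : ℝ :=
  (Real.cos p ^ 2 + a ^ 2 * Real.sin p ^ 2) * scaledAngle p a / a ^ 3
    + (1 - 1 / a ^ 2) * (Real.sin p * Real.cos p)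

/-- The partial derivative of `frozenPhase` in its second argument. -/
noncomputable def frozenPhaseSlope (p a : ℝ) : ℝ :=
  (3 * a * (Real.sin p * Real.cos p)
    - (3 * Real.cos p ^ 2 + a ^ 2 * Real.sin p ^ 2) * scaledAngle p a) / a ^ 4

theorem frozenPhase_zero (a : ℝ) : frozenPhase 0 a = 0 := by
  simp [frozenPhase, scaledAngle_zero]

theorem frozenPhase_one (p : ℝ) : frozenPhase p 1 = p := by
  simp [frozenPhase, scaledAngle_one]

theorem frozenPhaseSlope_neg {p a : ℝ} (ha : 0 < a) (hp : 0 < p) : frozenPhaseSlope p a < 0 :=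
  div_neg_of_neg_of_pos (sub_neg.2 (three_mul_sin_mul_cos_lt ha hp)) (by positivity)

theorem frozenPhaseSlope_nonpos {p a : ℝ} (ha : 0 < a) (hp : 0 ≤ p) :
    frozenPhaseSlope p a ≤ 0 := by
  rcases hp.eq_or_lt with rfl | hp
  · simp [frozenPhaseSlope, scaledAngle_zero]
  · exact (frozenPhaseSlope_neg ha hp).le

theorem hasDerivAt_frozenPhase_right {a : ℝ} (ha : 0 < a) (p : ℝ) :
    HasDerivAt (fun a => frozenPhase p a) (frozenPhaseSlope p a) a := by
  have hd := (cos_sq_add_mul_sin_sq_pos (pow_pos ha 2) p).ne'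
  have hi := hasDerivAt_id a
  refine ((((((hi.pow 2).mul_const (Real.sin p ^ 2)).const_add (Real.cos p ^ 2)).mul
    (hasDerivAt_scaledAngle_right ha p)).div (hi.pow 3) (pow_ne_zero 3 ha.ne')).add
    ((((hasDerivAt_const a (1 : ℝ)).div (hi.pow 2) (pow_ne_zero 2 ha.ne')).const_sub 1).mul_const
      (Real.sin p * Real.cos p))).congr_deriv ?_
  simp only [Pi.mul_apply, Pi.pow_apply, id, frozenPhaseSlope]
  rw [mul_div_cancel₀ _ hd]
  field_simp
  norm_num
  ring

theorem hasDerivAt_frozenPhase_left {a : ℝ} (ha : 0 < a) (p : ℝ) :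
    HasDerivAt (fun p => frozenPhase p a)
      (2 * (a ^ 2 - 1) * (Real.sin p * Real.cos p) * scaledAngle p a / a ^ 3 + 1 / a ^ 2
        + (1 - 1 / a ^ 2) * (Real.cos p ^ 2 - Real.sin p ^ 2)) p := by
  have hd := (cos_sq_add_mul_sin_sq_pos (pow_pos ha 2) p).ne'
  have hs := Real.hasDerivAt_sin p
  have hc := Real.hasDerivAt_cos p
  refine (((((hc.pow 2).add ((hs.pow 2).const_mul (a ^ 2))).mul
    (hasDerivAt_scaledAngle_left ha p)).div_const (a ^ 3)).add
    ((hs.mul hc).const_mul (1 - 1 / a ^ 2))).congr_deriv ?_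
  simp only [Pi.add_apply, Pi.pow_apply]
  rw [mul_div_cancel₀ _ hd]
  field_simp
  norm_num
  ring

theorem continuousOn_scaledAngle :
    ContinuousOn (fun x : ℝ × ℝ => scaledAngle x.1 x.2) {x | 0 < x.2} := by
  unfold scaledAngle
  refine continuousOn_fst.add (Real.continuous_arctan.comp_continuousOn
    (ContinuousOn.div (by fun_prop) (by fun_prop) fun x hx => ?_))
  exact (cos_sq_add_mul_sin_sq_pos hx x.1).ne'

theorem continuousOn_frozenPhase :
    ContinuousOn (fun x : ℝ × ℝ => frozenPhase x.1 x.2) {x | 0 < x.2} := by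
  have := continuousOn_scaledAngle
  unfold frozenPhase
  refine ContinuousOn.add (ContinuousOn.div (by fun_prop) (by fun_prop) fun x hx => ?_)
    (ContinuousOn.mul (continuousOn_const.sub (ContinuousOn.div (by fun_prop) (by fun_prop)
      fun x hx => ?_)) (by fun_prop))
  all_goals exact pow_ne_zero _ (ne_of_gt hx)

theorem continuousOn_frozenPhaseSlope :
    ContinuousOn (fun x : ℝ × ℝ => frozenPhaseSlope x.1 x.2) {x | 0 < x.2} := by
  have := continuousOn_scaledAngle
  unfold frozenPhaseSlope
  exact ContinuousOn.div (by fun_prop) (by fun_prop) fun x hx => pow_ne_zero _ (ne_of_gt hx)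

theorem abs_sin_sub_self_le_sq (d : ℝ) : |Real.sin d - d| ≤ d ^ 2 := by
  wlog hd : 0 ≤ d generalizing d
  · have := this (-d) (by linarith)
    rwa [Real.sin_neg, neg_sq, ← neg_sub', abs_neg] at this
  rw [abs_sub_comm, abs_of_nonneg (sub_nonneg.2 (Real.sin_le hd))]
  rcases le_total d 2 with h | h
  · rcases hd.eq_or_lt with rfl | h0
    · simp
    · nlinarith [Real.sin_gt_sub_cube h0, mul_nonneg (sq_nonneg d) (sub_nonneg.2 h)]
  · nlinarith [Real.neg_one_le_sin d]

theorem sin_sq_sub_sin_sq (a b : ℝ) :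
    Real.sin a ^ 2 - Real.sin b ^ 2 = Real.sin (a + b) * Real.sin (a - b) := by
  rw [Real.sin_add, Real.sin_sub]
  linear_combination Real.sin b ^ 2 * Real.sin_sq_add_cos_sq a
    - Real.sin a ^ 2 * Real.sin_sq_add_cos_sq b

theorem abs_sin_sq_sub_sin_sq_le (a b : ℝ) :
    |Real.sin a ^ 2 - Real.sin b ^ 2| ≤ |a - b| := by
  rw [sin_sq_sub_sin_sq, abs_mul]
  have h1 := Real.abs_sin_le_one (a + b)
  have h2 : |Real.sin (a - b)| ≤ |a - b| := by simpa using Real.abs_sin_sub_sin_le (a - b) 0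
  nlinarith [abs_nonneg (Real.sin (a - b))]

theorem abs_sin_sq_sub_linear_le (a b : ℝ) :
    |Real.sin a ^ 2 - Real.sin b ^ 2 - Real.sin (2 * b) * (a - b)| ≤ 2 * (a - b) ^ 2 := by
  have e : Real.sin a ^ 2 - Real.sin b ^ 2 - Real.sin (2 * b) * (a - b)
      = (Real.sin (a + b) - Real.sin (2 * b)) * Real.sin (a - b)
        + Real.sin (2 * b) * (Real.sin (a - b) - (a - b)) := by
    rw [sin_sq_sub_sin_sq]; ring
  have h1 : |Real.sin (a + b) - Real.sin (2 * b)| ≤ |a - b| :=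
    (Real.abs_sin_sub_sin_le _ _).trans_eq (by ring_nf)
  have h2 : |Real.sin (a - b)| ≤ |a - b| := by simpa using Real.abs_sin_sub_sin_le (a - b) 0
  have h3 := abs_sin_sub_self_le_sq (a - b)
  have h4 := Real.abs_sin_le_one (2 * b)
  calc _ ≤ |Real.sin (a + b) - Real.sin (2 * b)| * |Real.sin (a - b)|
        + |Real.sin (2 * b)| * |Real.sin (a - b) - (a - b)| := by
        rw [e, ← abs_mul, ← abs_mul]; exact abs_add_le _ _
    _ ≤ |a - b| * |a - b| + 1 * (a - b) ^ 2 := by gcongr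
    _ = _ := by rw [abs_mul_abs_self]; ring

theorem hasDerivAt_of_abs_sub_le_sq {f : ℝ → ℝ} {f' x C : ℝ}
    (h : ∀ᶠ y in 𝓝 x, |f y - f x - (y - x) * f'| ≤ C * (y - x) ^ 2) : HasDerivAt f f' x := by
  rw [hasDerivAt_iff_isLittleO]
  refine Asymptotics.IsBigO.trans_isLittleO (Asymptotics.IsBigO.of_bound C ?_)
    (Asymptotics.isLittleO_pow_sub_sub x one_lt_two)
  filter_upwards [h] with y hy
  simpa using hy

theorem gronwallBound_zero_le {K ε x b : ℝ} (hK : 0 < K) (hε : 0 ≤ ε) (hx : x ≤ b) :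
    gronwallBound 0 K ε x ≤ ε * ((Real.exp (K * b) - 1) / K) := by
  rw [gronwallBound_of_K_ne_0 hK.ne']
  have : Real.exp (K * x) ≤ Real.exp (K * b) := by gcongr
  calc _ = ε * ((Real.exp (K * x) - 1) / K) := by ring
    _ ≤ _ := by gcongr

/-- Lipschitz dependence of the Prüfer angle on the spectral parameter. -/
theorem abs_pruferAngle_sub_le {q u v : ℝ → ℝ} {b w z M : ℝ} (hM : 0 < M)
    (hq : ∀ x ∈ Icc 0 b, |q x| ≤ M) (hz : 0 < z) (hw : z / 2 ≤ w)
    (hu0 : u 0 = 0) (hv0 : v 0 = 0)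
    (hu : ∀ x ∈ Icc 0 b, HasDerivAt u (w - q x / w * Real.sin (u x) ^ 2) x)
    (hv : ∀ x ∈ Icc 0 b, HasDerivAt v (z - q x / z * Real.sin (v x) ^ 2) x) :
    ∀ x ∈ Icc 0 b, |u x - v x|
      ≤ |w - z| * ((1 + 2 * M / z ^ 2) * ((Real.exp (M / z * b) - 1) / (M / z))) := by
  intro x hx
  have hw0 : 0 < w := by linarith
  have hd : ∀ x ∈ Icc 0 b, HasDerivAt (fun x => u x - v x) _ x :=
    fun x hx => (hu x hx).sub (hv x hx)
  have h := norm_le_gronwallBound_of_norm_deriv_right_le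
    (K := M / z) (ε := |w - z| * (1 + 2 * M / z ^ 2)) (δ := 0)
    (fun x hx => (hd x hx).continuousAt.continuousWithinAt)
    (fun x hx => (hd x (Ico_subset_Icc_self hx)).hasDerivWithinAt)
    (by simp [hu0, hv0]) ?_ x hx
  · rw [Real.norm_eq_abs, sub_zero] at h
    refine h.trans ((gronwallBound_zero_le (by positivity) (by positivity)
      hx.2).trans_eq (by ring))
  intro t ht
  have hqt := hq t (Ico_subset_Icc_self ht)
  have e : w - q t / w * Real.sin (u t) ^ 2 - (z - q t / z * Real.sin (v t) ^ 2)
      = (w - z) * (1 + q t * (1 / (w * z)) * Real.sin (u t) ^ 2)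
        - q t / z * (Real.sin (u t) ^ 2 - Real.sin (v t) ^ 2) := by
    field_simp
    ring
  have hwz : 1 / (w * z) ≤ 2 / z ^ 2 := by
    rw [div_le_div_iff₀ (by positivity) (by positivity)]
    nlinarith
  have hs : |Real.sin (u t) ^ 2| ≤ 1 := by
    rw [abs_of_nonneg (sq_nonneg _)]; exact Real.sin_sq_le_one _
  have h1 : |1 + q t * (1 / (w * z)) * Real.sin (u t) ^ 2| ≤ 1 + M * (2 / z ^ 2) * 1 := by
    refine (abs_add_le _ _).trans ?_
    rw [abs_one, abs_mul, abs_mul, abs_of_pos (show 0 < 1 / (w * z) by positivity)]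
    gcongr
  have h2 := abs_sin_sq_sub_sin_sq_le (u t) (v t)
  simp only [Real.norm_eq_abs]
  rw [e]
  calc _ ≤ |w - z| * |1 + q t * (1 / (w * z)) * Real.sin (u t) ^ 2|
        + |q t| / z * |Real.sin (u t) ^ 2 - Real.sin (v t) ^ 2| := by
        refine (abs_sub _ _).trans_eq ?_
        rw [abs_mul, abs_mul, abs_div, abs_of_pos hz]
    _ ≤ |w - z| * (1 + M * (2 / z ^ 2) * 1) + M / z * |u t - v t| := by gcongr
    _ = _ := by ring

/-- The derivative of the Prüfer angle in the spectral parameter: `R` plays the role of `r²` and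
`S` that of the integral of `r² (1 + q sin² φ / z²)`. -/
theorem hasDerivAt_pruferAngle {q : ℝ → ℝ} {b z : ℝ} (hb : 0 ≤ b)
    (hq : ContinuousOn q (Icc 0 b)) (hz : 0 < z) {φ : ℝ → ℝ → ℝ}
    (hφ0 : ∀ w, 0 < w → φ 0 w = 0)
    (hφ : ∀ w, 0 < w → ∀ x ∈ Icc 0 b,
      HasDerivAt (fun t => φ t w) (w - q x / w * Real.sin (φ x w) ^ 2) x)
    {R S : ℝ → ℝ} (hRpos : ∀ x, 0 < R x) (hS0 : S 0 = 0)
    (hR : ∀ x ∈ Icc 0 b, HasDerivAt R (q x / z * Real.sin (2 * φ x z) * R x) x)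
    (hS : ∀ x ∈ Icc 0 b, HasDerivAt S (R x * (1 + q x / z ^ 2 * Real.sin (φ x z) ^ 2)) x) :
    HasDerivAt (φ b) (S b / R b) z := by
  obtain ⟨M₀, hM₀⟩ := isCompact_Icc.exists_bound_of_continuousOn hq
  obtain ⟨M, hM, hqM⟩ : ∃ M, 0 < M ∧ ∀ x ∈ Icc 0 b, |q x| ≤ M :=
    ⟨max M₀ 1, by positivity, fun x hx => (hM₀ x hx).trans (le_max_left _ _)⟩
  obtain ⟨B, hB⟩ := isCompact_Icc.exists_bound_of_continuousOn
    (fun x hx => (hR x hx).continuousAt.continuousWithinAt : ContinuousOn R (Icc 0 b))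
  set L := (1 + 2 * M / z ^ 2) * ((Real.exp (M / z * b) - 1) / (M / z)) with hL
  set C := B * (M / z * (2 * L ^ 2) + M * (2 / z ^ 3 + 1 / z ^ 2 * L)) with hC
  have hL0 : 0 ≤ L := by
    have : 0 ≤ Real.exp (M / z * b) - 1 := sub_nonneg.2 (Real.one_le_exp (by positivity))
    positivity
  have hB0 : 0 ≤ B := (norm_nonneg _).trans (hB 0 (left_mem_Icc.2 hb))
  refine hasDerivAt_of_abs_sub_le_sq (C := C * b / R b) ?_
  filter_upwards [Ioi_mem_nhds (half_lt_self hz)] with w hw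
  have hw : z / 2 < w := hw
  have hw0 : 0 < w := by linarith
  have hδ := abs_pruferAngle_sub_le hM hqM hz hw.le (hφ0 w hw0) (hφ0 z hz) (hφ w hw0) (hφ z hz)
  rw [← hL] at hδ
  have hE : ∀ x ∈ Icc 0 b,
      HasDerivAt (fun x => R x * (φ x w - φ x z) - (w - z) * S x) _ x := fun x hx =>
    ((hR x hx).mul ((hφ w hw0 x hx).sub (hφ z hz x hx))).sub ((hS x hx).const_mul (w - z))
  have hbound := norm_image_sub_le_of_norm_deriv_le_segment' (C := C * (w - z) ^ 2)
    (fun x hx => (hE x hx).hasDerivWithinAt) ?_ b (right_mem_Icc.2 hb)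
  · simp only [hφ0 w hw0, hφ0 z hz, hS0, sub_self, mul_zero, sub_zero, Real.norm_eq_abs]
      at hbound
    have hRb := hRpos b
    have e : φ b w - φ b z - (w - z) * (S b / R b)
        = (R b * (φ b w - φ b z) - (w - z) * S b) / R b := by field_simp
    rw [e, abs_div, abs_of_pos hRb, div_le_iff₀ hRb]
    refine hbound.trans_eq ?_
    field_simp
  intro x hx
  have hx := Ico_subset_Icc_self hx
  have hqx := hqM x hx
  have hδx := hδ x hx
  have hwz : |1 / (w * z) - 1 / z ^ 2| ≤ |w - z| * (2 / z ^ 3) := by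
    have e : 1 / (w * z) - 1 / z ^ 2 = -(w - z) * (1 / (w * z ^ 2)) := by field_simp; ring
    rw [e, abs_mul, abs_neg, abs_of_pos (show 0 < 1 / (w * z ^ 2) by positivity)]
    refine mul_le_mul_of_nonneg_left ?_ (abs_nonneg _)
    rw [div_le_div_iff₀ (by positivity) (by positivity)]
    nlinarith [pow_pos hz 2]
  have hs : |Real.sin (φ x w) ^ 2| ≤ 1 := by
    rw [abs_of_nonneg (sq_nonneg _)]; exact Real.sin_sq_le_one _
  have h1 := (abs_sin_sq_sub_sin_sq_le (φ x w) (φ x z)).trans hδx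
  have h2 : |Real.sin (φ x w) ^ 2 - Real.sin (φ x z) ^ 2
      - Real.sin (2 * φ x z) * (φ x w - φ x z)| ≤ 2 * (|w - z| * L) ^ 2 := by
    refine (abs_sin_sq_sub_linear_le _ _).trans ?_
    rw [← sq_abs (φ x w - φ x z)]
    gcongr
  have h3 : |(1 / (w * z) - 1 / z ^ 2) * Real.sin (φ x w) ^ 2
      + 1 / z ^ 2 * (Real.sin (φ x w) ^ 2 - Real.sin (φ x z) ^ 2)|
      ≤ |w - z| * (2 / z ^ 3) * 1 + 1 / z ^ 2 * (|w - z| * L) := by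
    refine (abs_add_le _ _).trans ?_
    rw [abs_mul, abs_mul, abs_of_pos (show 0 < 1 / z ^ 2 by positivity)]
    gcongr
  have e : q x / z * Real.sin (2 * φ x z) * R x * (φ x w - φ x z)
      + R x * (w - q x / w * Real.sin (φ x w) ^ 2 - (z - q x / z * Real.sin (φ x z) ^ 2))
      - (w - z) * (R x * (1 + q x / z ^ 2 * Real.sin (φ x z) ^ 2))
      = R x * (-(q x / z) * (Real.sin (φ x w) ^ 2 - Real.sin (φ x z) ^ 2
          - Real.sin (2 * φ x z) * (φ x w - φ x z))
        + (w - z) * (q x * ((1 / (w * z) - 1 / z ^ 2) * Real.sin (φ x w) ^ 2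
          + 1 / z ^ 2 * (Real.sin (φ x w) ^ 2 - Real.sin (φ x z) ^ 2)))) := by
    field_simp
    ring
  simp only [Pi.sub_apply]
  rw [e, Real.norm_eq_abs, abs_mul]
  have hBx : |R x| ≤ B := hB x hx
  calc _ ≤ |R x| * (|q x| / z * |Real.sin (φ x w) ^ 2 - Real.sin (φ x z) ^ 2
          - Real.sin (2 * φ x z) * (φ x w - φ x z)|
        + |w - z| * (|q x| * |(1 / (w * z) - 1 / z ^ 2) * Real.sin (φ x w) ^ 2
          + 1 / z ^ 2 * (Real.sin (φ x w) ^ 2 - Real.sin (φ x z) ^ 2)|)) := by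
        gcongr
        refine (abs_add_le _ _).trans_eq ?_
        rw [abs_mul, abs_mul, abs_mul, abs_neg, abs_div, abs_of_pos hz]
    _ ≤ B * (M / z * (2 * (|w - z| * L) ^ 2)
        + |w - z| * (M * (|w - z| * (2 / z ^ 3) * 1 + 1 / z ^ 2 * (|w - z| * L)))) := by
        gcongr
    _ = C * |w - z| ^ 2 := by rw [hC]; ring
    _ = _ := by rw [sq_abs]

theorem frozenPhase_stationary {a p z q R : ℝ} (ha : 0 < a) (hz : 0 < z)
    (hq : a ^ 2 = 1 - q / z ^ 2) :
    q / z * Real.sin (2 * p) * R * frozenPhase p a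
      + R * ((2 * (a ^ 2 - 1) * (Real.sin p * Real.cos p) * scaledAngle p a / a ^ 3 + 1 / a ^ 2
        + (1 - 1 / a ^ 2) * (Real.cos p ^ 2 - Real.sin p ^ 2))
          * (z - q / z * Real.sin p ^ 2))
      - z * (R * (1 + q / z ^ 2 * Real.sin p ^ 2)) = 0 := by
  obtain rfl : q = (1 - a ^ 2) * z ^ 2 := by
    field_simp at hq
    linarith
  rw [Real.sin_two_mul, frozenPhase, Real.cos_sq']
  field_simp
  linear_combination 2 * z * R * (1 - a ^ 2) * Real.sin p ^ 2 * a * (a ^ 2 - 1) * Real.cos_sq' p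

theorem antitoneOn_frozenPhase {R p σ c a₁ : ℝ}
    (h : ∀ a ∈ Icc 1 a₁, R * frozenPhaseSlope p a + c ≤ 0) :
    AntitoneOn (fun a => R * frozenPhase p a - σ + c * a) (Icc 1 a₁) := by
  have hd : ∀ a ∈ Icc 1 a₁, HasDerivAt (fun a => R * frozenPhase p a - σ + c * a)
      (R * frozenPhaseSlope p a + c) a := fun a ha =>
    ((((hasDerivAt_frozenPhase_right (one_pos.trans_le ha.1) p).const_mul R).sub_const
      σ).add ((hasDerivAt_id a).const_mul c)).congr_deriv (by rw [mul_one])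
  refine antitoneOn_of_deriv_nonpos (convex_Icc _ _)
    (fun a ha => (hd a ha).continuousAt.continuousWithinAt)
    (fun a ha => (hd a (interior_subset ha)).differentiableAt.differentiableWithinAt)
    fun a ha => ?_
  rw [(hd a (interior_subset ha)).deriv]
  exact h a (interior_subset ha)

/-- Comparison of the Prüfer flow with the flows of the potentials frozen along the way. -/
theorem frozenPhase_comparison {q v R S A : ℝ → ℝ} {z c u w : ℝ} (hz : 0 < z) (huw : u ≤ w)
    (hv : ∀ x ∈ Icc u w, HasDerivAt v (z - q x / z * Real.sin (v x) ^ 2) x)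
    (hR : ∀ x ∈ Icc u w, HasDerivAt R (q x / z * Real.sin (2 * v x) * R x) x)
    (hS : ∀ x ∈ Icc u w, HasDerivAt S (R x * (1 + q x / z ^ 2 * Real.sin (v x) ^ 2)) x)
    (hAsq : ∀ x ∈ Icc u w, A x ^ 2 = 1 - q x / z ^ 2) (hA1 : ∀ x ∈ Icc u w, 1 ≤ A x)
    (hAanti : AntitoneOn A (Icc u w)) (hAc : ContinuousOn A (Icc u w))
    (h : ∀ x ∈ Icc u w, ∀ a ∈ Icc 1 (A u), R x * frozenPhaseSlope (v x) a + c ≤ 0) :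
    R u * frozenPhase (v u) (A u) - z * S u + c * A u
      ≤ R w * frozenPhase (v w) (A w) - z * S w + c * A w := by
  refine le_of_antitone_of_hasDerivAt_zero
    (P := fun x a => R x * frozenPhase (v x) a - z * S x + c * a) huw ?_ ?_ ?_
  · have hvc : ContinuousOn v (Icc u w) := fun x hx => (hv x hx).continuousAt.continuousWithinAt
    have hRc : ContinuousOn R (Icc u w) := fun x hx => (hR x hx).continuousAt.continuousWithinAt
    have hSc : ContinuousOn S (Icc u w) := fun x hx => (hS x hx).continuousAt.continuousWithinAt
    have hN : ContinuousOn (fun x => frozenPhase (v x) (A x)) (Icc u w) :=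
      continuousOn_frozenPhase.comp (f := fun x => (v x, A x)) (hvc.prodMk hAc)
        fun x hx => one_pos.trans_le (hA1 x hx)
    exact ((hRc.mul hN).sub (continuousOn_const.mul hSc)).add (continuousOn_const.mul hAc)
  · intro x hx y hy hxy
    have hAu : ∀ t ∈ Icc u w, A t ∈ Icc 1 (A u) := fun t ht =>
      ⟨hA1 t ht, hAanti (left_mem_Icc.2 huw) ht ht.1⟩
    exact antitoneOn_frozenPhase (h y hy) (hAu y hy) (hAu x hx) (hAanti hx hy hxy)
  · intro x hx
    have ha := one_pos.trans_le (hA1 x hx)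
    have hN := (hasDerivAt_frozenPhase_left ha (v x)).comp x (hv x hx)
    have hd := (((hR x hx).mul hN).sub ((hS x hx).const_mul z)).add_const (c * A x)
    simp only [Function.comp_apply] at hd
    rw [frozenPhase_stationary ha hz (hAsq x hx)] at hd
    exact hd


/-!
**Statement 1.**  Let `q : [0,1] → ℝ` be continuous with `q ≤ 0` on `[0,1]`, and suppose `q`
is monotone increasing on `[0,x₀]` for some fixed `x₀ ∈ (0,1]`.  Set
`q₋ = min {q x : x ∈ [0,1]}` and let `θ(x,z) = φ(x,z)/z` be the rescaled Prüfer angle of the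
solution `y(x,z)` of `−y'' + q y = z² y`, `y(0) = 0`, `y'(0) = 1`.  (The Prüfer angle `φ`
satisfies `φ(0,z) = 0` and `∂φ/∂x = z − (q/z) sin² φ` for every `z > 0`.)  If there exists
`z ≥ √(−2 q₋)` (with `z > 0`) such that `∂θ/∂z (x₀,z) = 0`, then `q ≡ 0` on `(0,x₀]`.
-/
theorem prufer_theta_deriv_zero_implies_q_zero
    (q : ℝ → ℝ) (x₀ : ℝ) (hx₀ : x₀ ∈ Set.Ioc (0 : ℝ) 1)
    (hq_cont : ContinuousOn q (Set.Icc 0 1))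
    (hq_nonpos : ∀ x ∈ Set.Icc (0 : ℝ) 1, q x ≤ 0)
    (hq_mono : MonotoneOn q (Set.Icc 0 x₀))
    (qmin : ℝ) (hqmin : IsLeast (q '' Set.Icc 0 1) qmin)
    -- the Prüfer angle `φ x z` of the solution `y(·,z)`:
    (φ : ℝ → ℝ → ℝ)
    (hφ0 : ∀ z : ℝ, 0 < z → φ 0 z = 0)
    (hφ' : ∀ z : ℝ, 0 < z → ∀ x ∈ Set.Icc (0 : ℝ) 1,
      HasDerivAt (fun t => φ t z) (z - q x / z * Real.sin (φ x z) ^ 2) x)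
    -- there is `z ≥ √(−2 q₋)` with `∂θ/∂z (x₀, z) = 0`:
    (hz : ∃ z : ℝ, 0 < z ∧ Real.sqrt (-2 * qmin) ≤ z ∧
      HasDerivAt (fun w => φ x₀ w / w) 0 z) :
    ∀ x ∈ Set.Ioc (0 : ℝ) x₀, q x = 0 := by
  obtain ⟨z, hz, -, hθ⟩ := hz
  have hsub : Icc 0 x₀ ⊆ Icc (0 : ℝ) 1 := Icc_subset_Icc_right hx₀.2
  have hqc : ContinuousOn q (Icc 0 x₀) := hq_cont.mono hsub
  have hφz : ∀ x ∈ Icc 0 x₀, HasDerivAt (fun t => φ t z) _ x := fun x hx => hφ' z hz x (hsub hx)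
  have hφc : ContinuousOn (fun x => φ x z) (Icc 0 x₀) := fun x hx =>
    (hφz x hx).continuousAt.continuousWithinAt
  have hφmono : StrictMonoOn (fun x => φ x z) (Icc 0 x₀) := by
    refine strictMonoOn_of_deriv_pos (convex_Icc _ _) hφc fun x hx => ?_
    have hx := interior_subset hx
    rw [(hφz x hx).deriv, div_mul_eq_mul_div, ← neg_add_eq_sub, ← neg_div, ← neg_mul]
    have := neg_nonneg.2 (hq_nonpos x (hsub hx))
    positivity
  have h0mem : (0 : ℝ) ∈ Icc 0 x₀ := left_mem_Icc.2 hx₀.1.le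
  have hφnonneg : ∀ x ∈ Icc 0 x₀, 0 ≤ φ x z := fun x hx =>
    (hφ0 z hz).symm.trans_le (hφmono.monotoneOn h0mem hx hx.1)
  obtain ⟨G, -, hG⟩ := exists_hasDerivAt_of_continuousOn_Icc
    (f := fun x => q x / z * Real.sin (2 * φ x z)) hx₀.1.le (by fun_prop)
  set R : ℝ → ℝ := fun x => Real.exp (G x) with hRdef
  have hRpos : ∀ x, 0 < R x := fun x => Real.exp_pos _
  have hR : ∀ x ∈ Icc 0 x₀, HasDerivAt R (q x / z * Real.sin (2 * φ x z) * R x) x := fun x hx =>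
    (hG x hx).exp.congr_deriv (mul_comm _ _)
  have hRc : ContinuousOn R (Icc 0 x₀) := fun x hx => (hR x hx).continuousAt.continuousWithinAt
  obtain ⟨S, hS0, hS⟩ := exists_hasDerivAt_of_continuousOn_Icc
    (f := fun x => R x * (1 + q x / z ^ 2 * Real.sin (φ x z) ^ 2)) hx₀.1.le (by fun_prop)
  have hend : R x₀ * φ x₀ z - z * S x₀ = 0 := by
    have h := (hasDerivAt_pruferAngle hx₀.1.le hqc hz hφ0
      (fun w hw x hx => hφ' w hw x (hsub hx)) hRpos hS0 hR hS).div (hasDerivAt_id z) hz.ne'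
    have h := h.unique hθ
    have hne := (hRpos x₀).ne'
    simp only [id] at h
    field_simp at h
    linarith
  set A : ℝ → ℝ := fun x => √(1 - q x / z ^ 2) with hAdef
  have hκ : ∀ x ∈ Icc 0 x₀, 0 ≤ -q x / z ^ 2 := fun x hx =>
    div_nonneg (neg_nonneg.2 (hq_nonpos x (hsub hx))) (sq_nonneg z)
  have hAsq : ∀ x ∈ Icc 0 x₀, A x ^ 2 = 1 - q x / z ^ 2 := fun x hx =>
    Real.sq_sqrt (by linarith [hκ x hx, neg_div (z ^ 2) (q x)])
  have hA1 : ∀ x ∈ Icc 0 x₀, 1 ≤ A x := fun x hx =>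
    Real.one_le_sqrt.2 (by linarith [hκ x hx, neg_div (z ^ 2) (q x)])
  have hAanti : AntitoneOn A (Icc 0 x₀) := fun x hx y hy hxy => by
    have := hq_mono hx hy hxy
    simp only [hAdef]
    gcongr
  have hAc : ContinuousOn A (Icc 0 x₀) := by fun_prop
  have key (c u v : ℝ) (hu : 0 ≤ u) (huv : u ≤ v) (hv : v ≤ x₀)
      (h : ∀ x ∈ Icc u v, ∀ a ∈ Icc 1 (A u), R x * frozenPhaseSlope (φ x z) a + c ≤ 0) :
      R u * frozenPhase (φ u z) (A u) - z * S u + c * A u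
        ≤ R v * frozenPhase (φ v z) (A v) - z * S v + c * A v :=
    have hs : Icc u v ⊆ Icc 0 x₀ := Icc_subset_Icc hu hv
    frozenPhase_comparison (v := fun x => φ x z) hz huv (fun x hx => hφz x (hs hx))
      (fun x hx => hR x (hs hx)) (fun x hx => hS x (hs hx)) (fun x hx => hAsq x (hs hx))
      (fun x hx => hA1 x (hs hx)) (hAanti.mono hs) (hAc.mono hs) h
  intro x₁ hx₁
  have hx₁' : x₁ ∈ Icc 0 x₀ := Ioc_subset_Icc_self hx₁
  have hx₀' : x₀ ∈ Icc 0 x₀ := right_mem_Icc.2 hx₀.1.le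
  have hstart := key 0 0 x₁ le_rfl hx₁.1.le hx₁.2 fun x hx a ha => by
    rw [add_zero]
    exact mul_nonpos_of_nonneg_of_nonpos (hRpos x).le (frozenPhaseSlope_nonpos
      (one_pos.trans_le ha.1) (hφnonneg x ⟨hx.1, hx.2.trans hx₁.2⟩))
  simp only [hφ0 z hz, frozenPhase_zero, hS0, mul_zero, sub_zero, zero_mul, add_zero] at hstart
  obtain ⟨c, hc, hslope⟩ : ∃ c > 0, ∀ x ∈ Icc x₁ x₀, ∀ a ∈ Icc 1 (A x₁),
      R x * frozenPhaseSlope (φ x z) a + c ≤ 0 := by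
    have hs : Icc x₁ x₀ ⊆ Icc 0 x₀ := Icc_subset_Icc_left hx₁.1.le
    have hfst : MapsTo (Prod.fst : ℝ × ℝ → ℝ) (Icc x₁ x₀ ×ˢ Icc 1 (A x₁)) (Icc 0 x₀) :=
      fun y hy => hs hy.1
    have hcont : ContinuousOn (fun y : ℝ × ℝ => R y.1 * frozenPhaseSlope (φ y.1 z) y.2)
        (Icc x₁ x₀ ×ˢ Icc 1 (A x₁)) :=
      (hRc.comp continuousOn_fst hfst).mul (continuousOn_frozenPhaseSlope.comp
        ((hφc.comp continuousOn_fst hfst).prodMk continuousOn_snd)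
        fun y hy => one_pos.trans_le hy.2.1)
    obtain ⟨y, hy, hmax⟩ := (isCompact_Icc.prod isCompact_Icc).exists_isMaxOn
      ⟨(x₁, 1), left_mem_Icc.2 hx₁.2, left_mem_Icc.2 (hA1 x₁ hx₁')⟩ hcont
    refine ⟨-(R y.1 * frozenPhaseSlope (φ y.1 z) y.2), neg_pos.2 ?_, fun x hx a ha => ?_⟩
    · refine mul_neg_of_pos_of_neg (hRpos _)
        (frozenPhaseSlope_neg (one_pos.trans_le hy.2.1) ?_)
      exact (hφ0 z hz).symm.trans_lt (hφmono h0mem (hs hy.1) (hx₁.1.trans_le hy.1.1))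
    · have : R x * _ ≤ _ := hmax (mk_mem_prod hx ha)
      linarith
  have hstep := key c x₁ x₀ hx₁.1.le hx₁.2 le_rfl hslope
  have hAx := hAanti hx₁' hx₀' hx₁.2
  have hlast := antitoneOn_frozenPhase (σ := z * S x₀) (hslope x₀ (right_mem_Icc.2 hx₁.2))
    (left_mem_Icc.2 (hA1 x₁ hx₁')) ⟨hA1 x₀ hx₀', hAx⟩ (hA1 x₀ hx₀')
  simp only [frozenPhase_one, hend] at hlast
  have hA : A x₁ = 1 := by
    refine le_antisymm (le_of_mul_le_mul_left ?_ hc) (hA1 x₁ hx₁')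
    linarith
  have := hAsq x₁ hx₁'
  rw [hA] at this
  field_simp at this
  linarith
end

section
/- Let q : [0,1] → ℝ be continuous, nonpositive (q(x) ≤ 0 on [0,1]) and single-barrier, and set q₋ = min{q(x) : x ∈ [0,1]}. Let λ₁ < λ₂ < ⋯ denote the eigenvalues of the Dirichlet problem −y'' + q(x) y = λ y on [0,1] with y(0) = y(1) = 0. Then for any indices n, m with λ_n > λ_m ≥ −2q₋, one has λ_n / λ_m ≥ n² / m². -/
/-- `lam` is an eigenvalue of the Dirichlet problem `−y'' + q y = λ y` on `[a, b]`,
`y a = y b = 0`: there is a nontrivial solution (with derivative `y'` and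
`y'' = (q − λ) y` on `[a, b]`) satisfying the boundary conditions. -/
def IsDirichletEigenvalue (q : ℝ → ℝ) (a b lam : ℝ) : Prop :=
  ∃ y y' : ℝ → ℝ,
    (∀ x ∈ Set.Icc a b, HasDerivAt y (y' x) x) ∧
    (∀ x ∈ Set.Icc a b, HasDerivAt y' ((q x - lam) * y x) x) ∧
    (∃ x ∈ Set.Icc a b, y x ≠ 0) ∧
    y a = 0 ∧ y b = 0

namespace Prufer

open Set Filter Topology MeasureTheory
open Real (sin cos exp sinc)

/-- Variation of constants for a scalar linear differential equation. -/
lemma linear_eq_exp_mul {w A B : ℝ → ℝ} (hA : Continuous A) (hB : Continuous B)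
    (hw : ∀ x ∈ Icc (0 : ℝ) 1, HasDerivAt w (A x * w x + B x) x)
    {x : ℝ} (hx : x ∈ Icc (0 : ℝ) 1) :
    w x = exp (∫ t in (0 : ℝ)..x, A t) *
      (w 0 + ∫ t in (0 : ℝ)..x, exp (-∫ s in (0 : ℝ)..t, A s) * B t) := by
  set a : ℝ → ℝ := fun x ↦ ∫ t in (0 : ℝ)..x, A t with ha
  have ha' (x : ℝ) : HasDerivAt a (A x) x := hA.integral_hasStrictDerivAt 0 x |>.hasDerivAt
  have ha_cont : Continuous a := continuous_iff_continuousAt.2 fun x ↦ (ha' x).continuousAt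
  have hint : Continuous fun t ↦ exp (-a t) * B t := by fun_prop
  set h : ℝ → ℝ := fun x ↦ exp (-a x) * w x - ∫ t in (0 : ℝ)..x, exp (-a t) * B t with hh
  have hh' : ∀ x ∈ Icc (0 : ℝ) 1, HasDerivAt h 0 x := by
    intro x hx
    refine ((ha' x).fun_neg.exp.fun_mul (hw x hx)).fun_sub
      (hint.integral_hasStrictDerivAt 0 x).hasDerivAt |>.congr_deriv ?_
    ring
  have hconst : h x = h 0 := by
    refine constant_of_derivWithin_zero (a := 0) (b := 1)
      (fun x hx ↦ (hh' x hx).differentiableAt.differentiableWithinAt)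
      (fun x hx ↦ ?_) x hx
    exact ((hh' x (Ico_subset_Icc_self hx)).hasDerivWithinAt).derivWithin
      (uniqueDiffOn_Icc one_pos x (Ico_subset_Icc_self hx))
  have h0 : h 0 = w 0 := by simp [hh, ha]
  have : exp (-a x) * w x = w 0 + ∫ t in (0 : ℝ)..x, exp (-a t) * B t := by
    rw [← h0, ← hconst]; simp [hh]
  rw [← this, ← mul_assoc, ← Real.exp_add, add_neg_cancel, Real.exp_zero, one_mul]

lemma linear_nonneg {w A B : ℝ → ℝ} (hA : Continuous A) (hB : Continuous B)
    (hw : ∀ x ∈ Icc (0 : ℝ) 1, HasDerivAt w (A x * w x + B x) x)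
    (hB0 : ∀ x ∈ Icc (0 : ℝ) 1, 0 ≤ B x) (h0 : 0 ≤ w 0)
    {x : ℝ} (hx : x ∈ Icc (0 : ℝ) 1) : 0 ≤ w x := by
  rw [linear_eq_exp_mul hA hB hw hx]
  refine mul_nonneg (Real.exp_nonneg _) (add_nonneg h0 ?_)
  refine intervalIntegral.integral_nonneg hx.1 fun t ht ↦ ?_
  exact mul_nonneg (Real.exp_nonneg _) (hB0 t ⟨ht.1, ht.2.trans hx.2⟩)

lemma linear_pos {w A B : ℝ → ℝ} (hA : Continuous A) (hB : Continuous B)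
    (hw : ∀ x ∈ Icc (0 : ℝ) 1, HasDerivAt w (A x * w x + B x) x)
    (hB0 : ∀ x ∈ Icc (0 : ℝ) 1, 0 ≤ B x) (hB1 : ∃ x ∈ Icc (0 : ℝ) 1, 0 < B x)
    (h0 : 0 ≤ w 0) : 0 < w 1 := by
  rw [linear_eq_exp_mul hA hB hw (right_mem_Icc.2 zero_le_one)]
  refine mul_pos (Real.exp_pos _) (add_pos_of_nonneg_of_pos h0 ?_)
  have ha_cont : Continuous fun x ↦ ∫ t in (0 : ℝ)..x, A t :=
    intervalIntegral.continuous_primitive (fun a b ↦ hA.intervalIntegrable a b) 0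
  obtain ⟨x, hx, hBx⟩ := hB1
  refine intervalIntegral.integral_pos one_pos (by fun_prop)
    (fun t ht ↦ mul_nonneg (Real.exp_nonneg _) (hB0 t (Ioc_subset_Icc_self ht)))
    ⟨x, hx, mul_pos (Real.exp_pos _) hBx⟩

lemma abs_integral_le {A : ℝ → ℝ} {C x : ℝ}
    (hA : ∀ t ∈ Icc (0 : ℝ) 1, |A t| ≤ C) (hx : x ∈ Icc (0 : ℝ) 1) :
    |∫ t in (0 : ℝ)..x, A t| ≤ C := by
  have h := intervalIntegral.norm_integral_le_of_norm_le_const (a := 0) (b := x) (f := A) (C := C)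
    fun t ht ↦ by
      rw [uIoc_of_le hx.1] at ht
      exact hA t ⟨ht.1.le, ht.2.trans hx.2⟩
  have hC : 0 ≤ C := (abs_nonneg _).trans (hA 0 (by simp))
  rw [sub_zero, abs_of_nonneg hx.1, Real.norm_eq_abs] at h
  exact h.trans (mul_le_of_le_one_right hC hx.2)

lemma linear_abs_le {w A B : ℝ → ℝ} {C ε : ℝ} (hA : Continuous A) (hB : Continuous B)
    (hw : ∀ x ∈ Icc (0 : ℝ) 1, HasDerivAt w (A x * w x + B x) x)
    (hAC : ∀ x ∈ Icc (0 : ℝ) 1, |A x| ≤ C) (hBε : ∀ x ∈ Icc (0 : ℝ) 1, |B x| ≤ ε)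
    (h0 : w 0 = 0) {x : ℝ} (hx : x ∈ Icc (0 : ℝ) 1) : |w x| ≤ exp C * (exp C * ε) := by
  rw [linear_eq_exp_mul hA hB hw hx, h0, zero_add, abs_mul, Real.abs_exp]
  have hexp {y : ℝ} (hy : |y| ≤ C) : exp y ≤ exp C :=
    Real.exp_le_exp.2 ((le_abs_self y).trans hy)
  refine mul_le_mul (hexp (abs_integral_le hAC hx)) (abs_integral_le (fun t ht ↦ ?_) hx)
    (abs_nonneg _) (Real.exp_nonneg _)
  rw [abs_mul, Real.abs_exp]
  exact mul_le_mul (hexp (by rw [abs_neg]; exact abs_integral_le hAC ht)) (hBε t ht)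
    (abs_nonneg _) (Real.exp_nonneg _)

/-- `φ` is the solution on `[0, 1]` of the Prüfer equation `φ' = z + β sin² φ`, `φ 0 = 0`. -/
structure IsAngle (z : ℝ) (β φ : ℝ → ℝ) : Prop where
  cont : Continuous φ
  zero : φ 0 = 0
  deriv : ∀ x ∈ Icc (0 : ℝ) 1, HasDerivAt φ (z + β x * sin (φ x) ^ 2) x

lemma sin_sq_sub_sin_sq (a b : ℝ) : sin a ^ 2 - sin b ^ 2 = sin (a + b) * sin (a - b) := by
  rw [Real.sin_add, Real.sin_sub]
  linear_combination (-sin a ^ 2) * Real.sin_sq_add_cos_sq b +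
    (sin b ^ 2) * Real.sin_sq_add_cos_sq a

lemma sinc_mul_self (x : ℝ) : sinc x * x = sin x := by
  rcases eq_or_ne x 0 with rfl | hx
  · simp
  · rw [Real.sinc_of_ne_zero hx, div_mul_cancel₀ _ hx]

lemma exists_isAngle (z : ℝ) {β : ℝ → ℝ} (hβ : Continuous β) : ∃ φ, IsAngle z β φ := by
  obtain ⟨C, hC⟩ := isCompact_Icc.exists_bound_of_continuousOn (s := Icc (0 : ℝ) 1)
    hβ.continuousOn
  have hC0 : 0 ≤ C := (norm_nonneg _).trans (hC 0 (by simp))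
  have hsin (y : ℝ) : |sin y ^ 2| ≤ 1 := by
    rw [abs_pow]; exact pow_le_one₀ (abs_nonneg _) (Real.abs_sin_le_one y)
  have hPL : IsPicardLindelof (fun x y ↦ z + β x * sin y ^ 2)
      (⟨0, by simp⟩ : Icc (0 : ℝ) 1) 0 (Real.toNNReal (|z| + C)) 0
      (Real.toNNReal (|z| + C)) (Real.toNNReal C) := by
    have hzC : 0 ≤ |z| + C := by positivity
    refine ⟨fun t ht ↦ ?_, fun x _ ↦ by fun_prop, fun t ht x _ ↦ ?_, ?_⟩
    · refine LipschitzOnWith.of_dist_le_mul fun a _ b _ ↦ ?_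
      rw [Real.dist_eq, Real.dist_eq, Real.coe_toNNReal _ hC0]
      have : z + β t * sin a ^ 2 - (z + β t * sin b ^ 2)
          = β t * (sin (a + b) * sin (a - b)) := by
        rw [← sin_sq_sub_sin_sq]; ring
      rw [this, abs_mul, abs_mul]
      refine mul_le_mul (hC t ht) ?_ (by positivity) hC0
      calc _ ≤ 1 * |a - b| := mul_le_mul (Real.abs_sin_le_one _) Real.abs_sin_le_abs
            (abs_nonneg _) zero_le_one
        _ = _ := one_mul _
    · rw [Real.coe_toNNReal _ hzC, Real.norm_eq_abs]
      refine (abs_add_le _ _).trans (add_le_add le_rfl ?_)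
      rw [abs_mul]
      exact (mul_le_mul (hC t ht) (hsin x) (abs_nonneg _) hC0).trans_eq (mul_one C)
    · simp
  obtain ⟨ψ, hψ0, hψ⟩ := hPL.exists_eq_forall_mem_Icc_hasDerivWithinAt₀
  have hψc : ContinuousOn ψ (Icc 0 1) := fun x hx ↦ (hψ x hx).continuousWithinAt
  set χ : ℝ → ℝ := fun x ↦ ψ (projIcc 0 1 zero_le_one x)
  have hχ : Continuous χ :=
    (continuousOn_iff_continuous_domRestrict.1 hψc).comp continuous_projIcc
  have hχψ : ∀ x ∈ Icc (0 : ℝ) 1, χ x = ψ x := fun x hx ↦ by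
    simp only [χ, projIcc_of_mem zero_le_one hx]
  have hint : Continuous fun t ↦ z + β t * sin (χ t) ^ 2 := by fun_prop
  set φ : ℝ → ℝ := fun x ↦ ∫ t in (0 : ℝ)..x, (z + β t * sin (χ t) ^ 2)
  have hφ (x : ℝ) : HasDerivAt φ (z + β x * sin (χ x) ^ 2) x :=
    (hint.integral_hasStrictDerivAt 0 x).hasDerivAt
  have hφχ : ∀ x ∈ Icc (0 : ℝ) 1, φ x = χ x := by
    have hd : ∀ x ∈ Icc (0 : ℝ) 1, HasDerivWithinAt (fun x ↦ φ x - ψ x) 0 (Icc 0 1) x := by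
      intro x hx
      refine ((hφ x).hasDerivWithinAt.fun_sub (hψ x hx)).congr_deriv ?_
      rw [hχψ x hx]; ring
    intro x hx
    have := constant_of_derivWithin_zero (fun x hx ↦ (hd x hx).differentiableWithinAt)
      (fun x hx ↦ (hd x (Ico_subset_Icc_self hx)).derivWithin
        (uniqueDiffOn_Icc one_pos x (Ico_subset_Icc_self hx))) x hx
    have hφ0 : φ 0 = 0 := by simp [φ]
    change ψ 0 = 0 at hψ0
    rw [hφ0, hψ0, sub_zero, sub_eq_zero] at this
    rw [this, hχψ x hx]
  refine ⟨φ, continuous_iff_continuousAt.2 fun x ↦ (hφ x).continuousAt, by simp [φ],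
    fun x hx ↦ ?_⟩
  rw [hφχ x hx]
  exact hφ x

/-- The linear equation satisfied by the difference of two Prüfer angles. -/
lemma IsAngle.hasDerivAt_sub {z₁ z₂ : ℝ} {β₁ β₂ φ₁ φ₂ : ℝ → ℝ} (h₁ : IsAngle z₁ β₁ φ₁)
    (h₂ : IsAngle z₂ β₂ φ₂) {x : ℝ} (hx : x ∈ Icc (0 : ℝ) 1) :
    HasDerivAt (fun x ↦ φ₂ x - φ₁ x)
      (β₁ x * sin (φ₂ x + φ₁ x) * sinc (φ₂ x - φ₁ x) * (φ₂ x - φ₁ x) +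
        ((z₂ - z₁) + (β₂ x - β₁ x) * sin (φ₂ x) ^ 2)) x := by
  refine ((h₂.deriv x hx).fun_sub (h₁.deriv x hx)).congr_deriv ?_
  linear_combination -(β₁ x * sin (φ₂ x + φ₁ x)) * sinc_mul_self (φ₂ x - φ₁ x) +
    β₁ x * sin_sq_sub_sin_sq (φ₂ x) (φ₁ x)

lemma IsAngle.abs_sub_le {z₁ z₂ C ε : ℝ} {β₁ β₂ φ₁ φ₂ : ℝ → ℝ} (h₁ : IsAngle z₁ β₁ φ₁)
    (h₂ : IsAngle z₂ β₂ φ₂) (hβ₁ : Continuous β₁) (hβ₂ : Continuous β₂)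
    (hC : ∀ x ∈ Icc (0 : ℝ) 1, |β₁ x| ≤ C) (hz : |z₂ - z₁| ≤ ε)
    (hε : ∀ x ∈ Icc (0 : ℝ) 1, |β₂ x - β₁ x| ≤ ε) {x : ℝ} (hx : x ∈ Icc (0 : ℝ) 1) :
    |φ₂ x - φ₁ x| ≤ exp C * (exp C * (ε + ε)) := by
  have hc₁ := h₁.cont
  have hc₂ := h₂.cont
  have hsinc := Real.continuous_sinc
  refine linear_abs_le (w := fun x ↦ φ₂ x - φ₁ x) (by fun_prop) (by fun_prop)
    (fun x hx ↦ h₁.hasDerivAt_sub h₂ hx) (fun x hx ↦ ?_) (fun x hx ↦ ?_)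
    (by simp [h₁.zero, h₂.zero]) hx
  · rw [abs_mul, abs_mul]
    have h1 := mul_le_mul (hC x hx) (Real.abs_sin_le_one (φ₂ x + φ₁ x)) (abs_nonneg _)
      ((abs_nonneg _).trans (hC x hx))
    refine (mul_le_mul h1 (Real.abs_sinc_le_one _) (abs_nonneg _) ?_).trans_eq (by ring)
    simpa using (abs_nonneg _).trans (hC x hx)
  · refine (abs_add_le _ _).trans (add_le_add hz ?_)
    rw [abs_mul, abs_of_nonneg (sq_nonneg (sin (φ₂ x)))]
    exact (mul_le_of_le_one_right (abs_nonneg _) (Real.sin_sq_le_one _)).trans (hε x hx)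

lemma IsAngle.eqOn {z : ℝ} {β φ₁ φ₂ : ℝ → ℝ} (hβ : Continuous β) (h₁ : IsAngle z β φ₁)
    (h₂ : IsAngle z β φ₂) {x : ℝ} (hx : x ∈ Icc (0 : ℝ) 1) : φ₁ x = φ₂ x := by
  obtain ⟨C, hC⟩ := isCompact_Icc.exists_bound_of_continuousOn (s := Icc (0 : ℝ) 1)
    hβ.continuousOn
  have := h₁.abs_sub_le h₂ hβ hβ hC (ε := 0) (by simp) (by simp) hx
  rw [add_zero, mul_zero, mul_zero] at this
  linarith [abs_nonpos_iff.1 this]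

lemma IsAngle.mono {z : ℝ} {β₁ β₂ φ₁ φ₂ : ℝ → ℝ} (hβ₁ : Continuous β₁) (hβ₂ : Continuous β₂)
    (h₁ : IsAngle z β₁ φ₁) (h₂ : IsAngle z β₂ φ₂) (hz : z ≠ 0)
    (hβ : ∀ x ∈ Icc (0 : ℝ) 1, β₁ x < β₂ x) : φ₁ 1 < φ₂ 1 := by
  have hc₁ := h₁.cont
  have hc₂ := h₂.cont
  have hsinc := Real.continuous_sinc
  rw [← sub_pos]
  refine linear_pos (w := fun x ↦ φ₂ x - φ₁ x) (by fun_prop) (by fun_prop)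
    (fun x hx ↦ h₁.hasDerivAt_sub h₂ hx) (fun x hx ↦ ?_) ?_ (by simp [h₁.zero, h₂.zero])
  · have := sub_nonneg.2 (hβ x hx).le
    rw [sub_self, zero_add]
    positivity
  · have hd : HasDerivAt (fun x ↦ sin (φ₂ x)) z 0 := by
      simpa [h₂.zero] using (h₂.deriv 0 (by simp)).sin
    have hne : ∀ᶠ x in 𝓝[>] (0 : ℝ), sin (φ₂ x) ≠ 0 :=
      (hd.eventually_ne hz).filter_mono (nhdsWithin_mono _ fun x hx ↦ ne_of_gt hx)
    have hmem : ∀ᶠ x in 𝓝[>] (0 : ℝ), x ∈ Ioo (0 : ℝ) 1 := Ioo_mem_nhdsGT one_pos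
    obtain ⟨x, hx, hxm⟩ := (hne.and hmem).exists
    refine ⟨x, Ioo_subset_Icc_self hxm, ?_⟩
    have := sub_pos.2 (hβ x (Ioo_subset_Icc_self hxm))
    rw [sub_self, zero_add]
    positivity

lemma IsAngle.hasDerivAt_self {z : ℝ} {β φ : ℝ → ℝ} (h : IsAngle z β φ) {x : ℝ}
    (hx : x ∈ Icc (0 : ℝ) 1) :
    HasDerivAt φ (β x * sin (φ x) * sinc (φ x) * φ x + z) x := by
  refine (h.deriv x hx).congr_deriv ?_
  linear_combination -(β x * sin (φ x)) * sinc_mul_self (φ x)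

lemma IsAngle.nonneg {z : ℝ} {β φ : ℝ → ℝ} (hβ : Continuous β) (h : IsAngle z β φ) (hz : 0 < z)
    {x : ℝ} (hx : x ∈ Icc (0 : ℝ) 1) : 0 ≤ φ x := by
  have hc := h.cont
  have hsinc := Real.continuous_sinc
  exact linear_nonneg (by fun_prop) (by fun_prop) (fun x hx ↦ h.hasDerivAt_self hx)
    (fun _ _ ↦ hz.le) h.zero.ge hx

lemma IsAngle.pos {z : ℝ} {β φ : ℝ → ℝ} (hβ : Continuous β) (h : IsAngle z β φ) (hz : 0 < z) :
    0 < φ 1 := by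
  have hc := h.cont
  have hsinc := Real.continuous_sinc
  exact linear_pos (by fun_prop) (by fun_prop) (fun x hx ↦ h.hasDerivAt_self hx)
    (fun _ _ ↦ hz.le) ⟨0, by simp, hz⟩ h.zero.ge

lemma IsAngle.le_pi_div_two {β φ : ℝ → ℝ} (hβ : Continuous β) (h : IsAngle 1 β φ)
    (hβ1 : ∀ x ∈ Icc (0 : ℝ) 1, β x ≤ -1) : φ 1 ≤ Real.pi / 2 := by
  have hc := h.cont
  have hsinc := Real.continuous_sinc
  rw [← sub_nonneg]
  refine linear_nonneg (w := fun x ↦ Real.pi / 2 - φ x)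
    (A := fun x ↦ -(cos (φ x) * sinc (Real.pi / 2 - φ x)))
    (B := fun x ↦ (-1 - β x) * sin (φ x) ^ 2) (by fun_prop) (by fun_prop)
    (fun x hx ↦ ?_) (fun x hx ↦ ?_) (by simp only [h.zero, sub_zero]; positivity) (by simp)
  · refine ((h.deriv x hx).const_sub (Real.pi / 2)).congr_deriv ?_
    have h1 := sinc_mul_self (Real.pi / 2 - φ x)
    rw [Real.sin_pi_div_two_sub] at h1
    linear_combination cos (φ x) * h1 + Real.sin_sq_add_cos_sq (φ x)
  · exact mul_nonneg (by linarith [hβ1 x hx]) (sq_nonneg _)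

/-- With `β = (lam - q) / z - z`, the boundary value at `1` of the Prüfer angle detects the
eigenvalues. -/
lemma isDirichletEigenvalue_of_sin_eq_zero {q φ : ℝ → ℝ} {lam z : ℝ} (hq : Continuous q)
    (hz : 0 < z) (h : IsAngle z (fun x ↦ (lam - q x) / z - z) φ) (h1 : sin (φ 1) = 0) :
    IsDirichletEigenvalue q 0 1 lam := by
  have hc := h.cont
  set A : ℝ → ℝ := fun x ↦ -((lam - q x) / z - z) * sin (φ x) * cos (φ x) with hA_def
  have hA : Continuous A := by fun_prop
  set R : ℝ → ℝ := fun x ↦ exp (∫ t in (0 : ℝ)..x, A t) with hR_def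
  have hR (x : ℝ) : HasDerivAt R (R x * A x) x :=
    (hA.integral_hasStrictDerivAt 0 x).hasDerivAt.exp
  have hd : ∀ x ∈ Icc (0 : ℝ) 1, HasDerivAt (fun x ↦ R x * sin (φ x) / z)
      (R x * cos (φ x)) x := by
    intro x hx
    refine (((hR x).fun_mul (h.deriv x hx).sin).div_const z).congr_deriv ?_
    simp only [hA_def]
    field_simp
    ring
  refine ⟨_, _, hd, fun x hx ↦ ?_, ?_, ?_, ?_⟩
  · refine ((hR x).fun_mul (h.deriv x hx).cos).congr_deriv ?_
    simp only [hA_def]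
    field_simp
    linear_combination R x * sin (φ x) * (-lam + q x + z ^ 2) * Real.sin_sq_add_cos_sq (φ x)
  · by_contra! hcon
    have h0 : (0 : ℝ) ∈ Icc (0 : ℝ) 1 := by simp
    have hsin : ∀ x ∈ Icc (0 : ℝ) 1, sin (φ x) = 0 := fun x hx ↦ by
      have := hcon x hx
      rw [div_eq_zero_iff, mul_eq_zero] at this
      exact (this.resolve_right hz.ne').resolve_left (Real.exp_ne_zero _)
    have hpos : HasDerivAt (fun x ↦ sin (φ x)) z 0 := by
      simpa [h.zero] using (h.deriv 0 h0).sin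
    have hne : ∀ᶠ x in 𝓝[>] (0 : ℝ), sin (φ x) ≠ 0 :=
      (hpos.eventually_ne hz.ne').filter_mono (nhdsWithin_mono _ fun x hx ↦ ne_of_gt hx)
    have hmem : ∀ᶠ x in 𝓝[>] (0 : ℝ), x ∈ Ioo (0 : ℝ) 1 := Ioo_mem_nhdsGT one_pos
    obtain ⟨x, hx, hxm⟩ := (hne.and hmem).exists
    exact hx (hsin x (Ioo_subset_Icc_self hxm))
  · simp [h.zero]
  · simp [h1]

lemma sin_eq_zero_of_isDirichletEigenvalue {q φ : ℝ → ℝ} {lam z : ℝ} (hq : Continuous q)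
    (hz : 0 < z) (h : IsAngle z (fun x ↦ (lam - q x) / z - z) φ)
    (hlam : IsDirichletEigenvalue q 0 1 lam) : sin (φ 1) = 0 := by
  obtain ⟨y, y', hy, hy', ⟨x₁, hx₁, hne⟩, h0, h1⟩ := hlam
  have hc := h.cont
  set A : ℝ → ℝ := fun x ↦ -((lam - q x) / z - z) * sin (φ x) * cos (φ x) with hA_def
  have hA : Continuous A := by fun_prop
  set G : ℝ → ℝ := fun x ↦ z * y x * cos (φ x) - y' x * sin (φ x) with hG_def
  set R : ℝ → ℝ := fun x ↦ z * y x * sin (φ x) + y' x * cos (φ x) with hR_def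
  have hG' : ∀ x ∈ Icc (0 : ℝ) 1, HasDerivAt G (-A x * G x + 0) x := by
    intro x hx
    have hφ := h.deriv x hx
    refine ((((hy x hx).const_mul z).fun_mul hφ.cos).fun_sub
      ((hy' x hx).fun_mul hφ.sin)).congr_deriv ?_
    have hs := Real.sin_sq_add_cos_sq (φ x)
    have hc2 : cos (φ x) ^ 2 = 1 - sin (φ x) ^ 2 := by linarith
    simp only [hA_def, hG_def]
    field_simp
    ring_nf
    simp only [hc2]
    ring
  have hG : ∀ x ∈ Icc (0 : ℝ) 1, G x = 0 := by
    intro x hx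
    have h00 : G 0 = 0 := by simp [hG_def, h0, h.zero]
    rw [linear_eq_exp_mul (B := fun _ ↦ 0) hA.neg continuous_const hG' hx, h00]
    simp
  have hyR : ∀ x ∈ Icc (0 : ℝ) 1, z * y x = R x * sin (φ x) := by
    intro x hx
    have := hG x hx
    simp only [hG_def] at this
    simp only [hR_def]
    linear_combination cos (φ x) * this - z * y x * Real.sin_sq_add_cos_sq (φ x)
  have hyR' : ∀ x ∈ Icc (0 : ℝ) 1, y' x = R x * cos (φ x) := by
    intro x hx
    have := hG x hx
    simp only [hG_def] at this
    simp only [hR_def]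
    linear_combination -sin (φ x) * this - y' x * Real.sin_sq_add_cos_sq (φ x)
  have hR' : ∀ x ∈ Icc (0 : ℝ) 1, HasDerivAt R (A x * R x + 0) x := by
    intro x hx
    have hφ := h.deriv x hx
    refine ((((hy x hx).const_mul z).fun_mul hφ.sin).fun_add
      ((hy' x hx).fun_mul hφ.cos)).congr_deriv ?_
    have e1 := hyR x hx
    have e3 : y x = R x * sin (φ x) / z := by field_simp; linarith
    rw [hyR' x hx, e3]
    have hs := Real.sin_sq_add_cos_sq (φ x)
    have hc2 : cos (φ x) ^ 2 = 1 - sin (φ x) ^ 2 := by linarith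
    simp only [hA_def]
    field_simp
    ring
  have hRx (x : ℝ) (hx : x ∈ Icc (0 : ℝ) 1) : R x = exp (∫ t in (0 : ℝ)..x, A t) * R 0 := by
    rw [linear_eq_exp_mul (B := fun _ ↦ 0) hA continuous_const hR' hx]
    simp
  have hR0 : R 0 ≠ 0 := by
    intro h00
    have := hyR x₁ hx₁
    rw [hRx x₁ hx₁, h00, mul_zero, zero_mul, mul_eq_zero] at this
    exact this.elim hz.ne' hne
  have h11 : (1 : ℝ) ∈ Icc (0 : ℝ) 1 := by simp
  have := hyR 1 h11
  rw [h1, mul_zero, hRx 1 h11] at this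
  exact (mul_eq_zero.1 this.symm).resolve_left (mul_ne_zero (Real.exp_ne_zero _) hR0)

lemma sin_int_mul_pi_add_pi_div_two_ne_zero (k : ℤ) : sin (k * Real.pi + Real.pi / 2) ≠ 0 := by
  rw [Real.sin_add_pi_div_two]
  intro h
  have h1 := Real.sin_sq_add_cos_sq (k * Real.pi)
  rw [h, Real.sin_int_mul_pi] at h1
  norm_num at h1

/-- A continuous function on an interval with values in `π ℤ` is constant. -/
lemma eq_of_sin_eq_zero {f : ℝ → ℝ} {a b : ℝ} (hf : ContinuousOn f (uIcc a b))
    (hsin : ∀ x ∈ uIcc a b, sin (f x) = 0) : f a = f b := by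
  have key (u v : ℝ) (hu : sin u = 0) (hv : sin v = 0) (huv : u < v) :
      ∃ w ∈ Icc u v, sin w ≠ 0 := by
    obtain ⟨k, rfl⟩ := Real.sin_eq_zero_iff.1 hu
    obtain ⟨l, rfl⟩ := Real.sin_eq_zero_iff.1 hv
    refine ⟨k * Real.pi + Real.pi / 2, ⟨by linarith [Real.pi_pos], ?_⟩,
      sin_int_mul_pi_add_pi_div_two_ne_zero k⟩
    have hkl : k < l := by exact_mod_cast lt_of_mul_lt_mul_right huv Real.pi_pos.le
    have : (k : ℝ) + 1 ≤ l := by exact_mod_cast hkl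
    nlinarith [Real.pi_pos]
  have hIVT := intermediate_value_uIcc hf
  by_contra hne
  rcases lt_or_gt_of_ne hne with h | h
  · obtain ⟨w, hw, hw'⟩ := key _ _ (hsin a left_mem_uIcc) (hsin b right_mem_uIcc) h
    obtain ⟨x, hx, rfl⟩ := hIVT (Icc_subset_uIcc hw)
    exact hw' (hsin x hx)
  · obtain ⟨w, hw, hw'⟩ := key _ _ (hsin b right_mem_uIcc) (hsin a left_mem_uIcc) h
    obtain ⟨x, hx, rfl⟩ := hIVT (Icc_subset_uIcc' hw)
    exact hw' (hsin x hx)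

/-- Continuous dependence of the Prüfer angle on a real parameter. -/
lemma continuousAt_isAngle {β φ : ℝ → ℝ → ℝ} {z : ℝ → ℝ} {p₀ x : ℝ}
    (hφ : ∀ᶠ p in 𝓝 p₀, IsAngle (z p) (β p) (φ p))
    (hβ : ∀ᶠ p in 𝓝 p₀, Continuous (β p)) (hz : ContinuousAt z p₀)
    (hβ' : ∀ ε > 0, ∀ᶠ p in 𝓝 p₀, ∀ x ∈ Icc (0 : ℝ) 1, |β p x - β p₀ x| ≤ ε)
    (hx : x ∈ Icc (0 : ℝ) 1) : ContinuousAt (fun p ↦ φ p x) p₀ := by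
  obtain ⟨C, hC⟩ := isCompact_Icc.exists_bound_of_continuousOn (s := Icc (0 : ℝ) 1)
    hβ.self_of_nhds.continuousOn
  rw [Metric.continuousAt_iff']
  intro ε hε
  set δ : ℝ := ε / (4 * (exp C * exp C)) with hδ
  have hδ0 : 0 < δ := by positivity
  filter_upwards [hφ, hβ, hβ' δ hδ0, Metric.continuousAt_iff'.1 hz δ hδ0] with p h1 h2 h3 h4
  rw [Real.dist_eq] at h4 ⊢
  refine (hφ.self_of_nhds.abs_sub_le h1 hβ.self_of_nhds h2 hC h4.le h3 hx).trans_lt ?_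
  have : exp C * (exp C * (δ + δ)) = ε / 2 := by
    rw [hδ]; field_simp; ring
  linarith

lemma continuous_isAngle_lam {q : ℝ → ℝ} (hq : Continuous q) {θ : ℝ → ℝ → ℝ}
    (hθ : ∀ lam, IsAngle 1 (fun x ↦ (lam - q x) / 1 - 1) (θ lam)) :
    Continuous fun lam ↦ θ lam 1 := by
  refine continuous_iff_continuousAt.2 fun lam ↦ ?_
  refine continuousAt_isAngle (z := fun _ ↦ 1) (.of_forall hθ)
    (.of_forall fun lam ↦ by fun_prop) continuousAt_const (fun ε hε ↦ ?_) (by simp)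
  filter_upwards [Metric.ball_mem_nhds lam hε] with p hp x _
  rw [Metric.mem_ball, Real.dist_eq] at hp
  rw [show (p - q x) / 1 - 1 - ((lam - q x) / 1 - 1) = p - lam by ring]
  exact hp.le

lemma isAngle_eq_of_isDirichletEigenvalue {q φ θ : ℝ → ℝ} {lam z : ℝ} (hq : Continuous q)
    (hz : 0 < z) (h : IsAngle z (fun x ↦ (lam - q x) / z - z) φ)
    (hθ : IsAngle 1 (fun x ↦ (lam - q x) / 1 - 1) θ)
    (hlam : IsDirichletEigenvalue q 0 1 lam) : φ 1 = θ 1 := by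
  have hβ (c : ℝ) : Continuous (fun x ↦ (lam - q x) / c - c) := by fun_prop
  choose ψ hψ using fun c : ℝ ↦ exists_isAngle c (hβ c)
  have h1 : (1 : ℝ) ∈ Icc (0 : ℝ) 1 := by simp
  rw [h.eqOn (hβ z) (hψ z) h1, hθ.eqOn (hβ 1) (hψ 1) h1]
  obtain ⟨C, hC⟩ := isCompact_Icc.exists_bound_of_continuousOn (s := Icc (0 : ℝ) 1)
    (f := fun x ↦ lam - q x) (by fun_prop)
  have hC0 : 0 ≤ C := (norm_nonneg _).trans (hC 0 (by simp))
  have hpos : ∀ c ∈ uIcc z 1, 0 < c := fun c hc ↦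
    (lt_min hz one_pos).trans_le hc.1
  refine eq_of_sin_eq_zero (f := fun c ↦ ψ c 1) (fun c hc ↦ ?_) fun c hc ↦
    sin_eq_zero_of_isDirichletEigenvalue hq (hpos c hc) (hψ c) hlam
  refine (continuousAt_isAngle (z := fun c ↦ c) (.of_forall hψ) (.of_forall hβ)
    continuousAt_id (fun ε hε ↦ ?_) h1).continuousWithinAt
  have hc0 := hpos c hc
  have hlim : Tendsto (fun p ↦ C * |p⁻¹ - c⁻¹| + |p - c|) (𝓝 c) (𝓝 0) := by
    have : ContinuousAt (fun p : ℝ ↦ C * |p⁻¹ - c⁻¹| + |p - c|) c := by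
      have := hc0.ne'
      fun_prop (disch := assumption)
    simpa [ContinuousAt] using this
  filter_upwards [hlim.eventually (gt_mem_nhds hε)] with p hp x hx
  have e : (lam - q x) / p - p - ((lam - q x) / c - c)
      = (lam - q x) * (p⁻¹ - c⁻¹) - (p - c) := by ring
  rw [e]
  refine (abs_sub _ _).trans (le_trans ?_ hp.le)
  rw [abs_mul]
  exact add_le_add (mul_le_mul_of_nonneg_right (hC x hx) (abs_nonneg _)) le_rfl

lemma pnat_strictMono_eq_self {k : ℕ+ → ℕ+} (hk : StrictMono k)
    (hk' : ∀ n, ∀ j ≤ k n, ∃ i, k i = j) (n : ℕ+) : k n = n := by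
  have hsurj : Function.Surjective k := fun j ↦ hk' j j hk.le_apply
  exact congrArg (fun e : ℕ+ ≃o ℕ+ ↦ e n)
    (Subsingleton.elim (hk.orderIsoOfSurjective k hsurj) (OrderIso.refl ℕ+))

/-- At the `n`-th eigenvalue the Prüfer angle at `1` equals `n π`. -/
lemma isAngle_eigenvalue_eq {q : ℝ → ℝ} (hq : Continuous q) {c : ℝ} (hc : ∀ x, c ≤ q x)
    {θ : ℝ → ℝ → ℝ} (hθ : ∀ lam, IsAngle 1 (fun x ↦ (lam - q x) / 1 - 1) (θ lam))
    {μ : ℕ+ → ℝ} (hμ_mono : StrictMono μ)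
    (hμ_eig : ∀ n : ℕ+, IsDirichletEigenvalue q 0 1 (μ n))
    (hμ_all : ∀ lam : ℝ, IsDirichletEigenvalue q 0 1 lam → ∃ n : ℕ+, μ n = lam) (n : ℕ+) :
    θ (μ n) 1 = n * Real.pi ∧ c < μ n := by
  have hβ (lam : ℝ) : Continuous fun x ↦ (lam - q x) / 1 - 1 := by fun_prop
  have hmono : StrictMono fun lam ↦ θ lam 1 := fun a b hab ↦
    (hθ a).mono (hβ a) (hβ b) (hθ b) one_ne_zero fun x _ ↦ by simpa using hab
  have hlow : θ c 1 ≤ Real.pi / 2 := (hθ c).le_pi_div_two (hβ c) fun x _ ↦ by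
    simpa using hc x
  have hk (n : ℕ+) : ∃ k : ℕ+, θ (μ n) 1 = k * Real.pi := by
    have h0 := sin_eq_zero_of_isDirichletEigenvalue hq one_pos (hθ (μ n)) (hμ_eig n)
    obtain ⟨k, hk⟩ := Real.sin_eq_zero_iff.1 h0
    have hpos := (hθ (μ n)).pos (hβ _) one_pos
    rw [← hk] at hpos
    have hk0 : 0 < k := by exact_mod_cast pos_of_mul_pos_left hpos Real.pi_pos.le
    lift k to ℕ using hk0.le
    exact ⟨⟨k, by exact_mod_cast hk0⟩, by simpa using hk.symm⟩
  choose k hk using hk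
  have hkmono : StrictMono k := fun a b hab ↦ by
    have := hmono (hμ_mono hab)
    simp only [hk] at this
    exact_mod_cast lt_of_mul_lt_mul_right this Real.pi_pos.le
  have hge (j : ℕ+) : Real.pi ≤ j * Real.pi :=
    le_mul_of_one_le_left Real.pi_pos.le (by exact_mod_cast j.pos)
  have hlt (n : ℕ+) : c < μ n := by
    have h1 := hge (k n)
    rw [← hk] at h1
    exact hmono.lt_iff_lt.1 (show θ c 1 < θ (μ n) 1 by linarith [Real.pi_pos])
  refine ⟨?_, hlt n⟩
  rw [hk, pnat_strictMono_eq_self hkmono]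
  intro n j hj
  have hmem : (j : ℝ) * Real.pi ∈ Icc (θ c 1) (θ (μ n) 1) := by
    refine ⟨by linarith [hge j, Real.pi_pos], ?_⟩
    rw [hk]
    exact mul_le_mul_of_nonneg_right (by exact_mod_cast hj) Real.pi_pos.le
  obtain ⟨lam, -, hlam⟩ := intermediate_value_Icc (hlt n).le
    (continuous_isAngle_lam hq hθ).continuousOn hmem
  obtain ⟨i, hi⟩ := hμ_all lam (isDirichletEigenvalue_of_sin_eq_zero hq one_pos (hθ lam) (by
    simp only at hlam
    rw [hlam, Real.sin_nat_mul_pi]))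
  refine ⟨i, ?_⟩
  have : (k i : ℝ) * Real.pi = j * Real.pi := by rw [← hk, hi, ← hlam]
  exact_mod_cast mul_right_cancel₀ Real.pi_ne_zero this

lemma mul_cos_le_sin {t : ℝ} (h0 : 0 ≤ t) (hpi : t ≤ Real.pi) : t * cos t ≤ sin t := by
  have hs := Real.sin_nonneg_of_nonneg_of_le_pi h0 hpi
  rcases lt_or_ge t (Real.pi / 2) with h | h
  · have hc : 0 < cos t := Real.cos_pos_of_mem_Ioo ⟨by linarith [Real.pi_pos], h⟩
    have := Real.le_tan h0 h
    rwa [Real.tan_eq_sin_div_cos, le_div_iff₀ hc] at this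
  · have hc : cos t ≤ 0 := Real.cos_nonpos_of_pi_div_two_le_of_le h (by linarith)
    nlinarith

lemma one_add_mul_sin_sq_pos {a : ℝ} (ha : -1 < a) (t : ℝ) : 0 < 1 + a * sin t ^ 2 := by
  rcases le_or_gt 0 a with h | h
  · positivity
  · nlinarith [Real.sin_sq_le_one t]

/-- An explicit majorant, vanishing at `0`, of the integral in `integral_kernel_deriv_nonpos`. -/
noncomputable def majorant (a s : ℝ) : ℝ :=
  (s * (sin s ^ 2 / (1 + a * sin s ^ 2) ^ 2) -
    ((3 + 12 * a - 3 * a ^ 2) * ((s - sin s * cos s) / 2) -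
      (10 * a - 2 * a ^ 2) * (3 * s / 8 - 3 * (sin s * cos s) / 8 - sin s ^ 3 * cos s / 4)) /
        (1 + a) ^ 4) / 2

lemma majorant_hasDerivAt {a : ℝ} (ha : 0 ≤ a) (s : ℝ) :
    HasDerivAt (majorant a)
      ((1 - a * sin s ^ 2) / (1 + a * sin s ^ 2) ^ 3 * (sin s * (s * cos s - sin s)) +
        (sin s ^ 2 * (3 - a * sin s ^ 2) / (1 + a * sin s ^ 2) ^ 3 -
          ((3 + 12 * a - 3 * a ^ 2) * sin s ^ 2 - (10 * a - 2 * a ^ 2) * sin s ^ 4) /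
            (1 + a) ^ 4) / 2) s := by
  have hp := (one_add_mul_sin_sq_pos (show -1 < a by linarith) s).ne'
  have ha1 : 1 + a ≠ 0 := by linarith
  have hS := Real.hasDerivAt_sin s
  have hC := Real.hasDerivAt_cos s
  have hu : HasDerivAt (fun s ↦ sin s ^ 2) (2 * sin s * cos s) s :=
    (hS.fun_pow 2).congr_deriv (by simp)
  have hden : HasDerivAt (fun s ↦ (1 + a * sin s ^ 2) ^ 2)
      (2 * (1 + a * sin s ^ 2) * (a * (2 * sin s * cos s))) s :=
    (((hu.const_mul a).const_add 1).fun_pow 2).congr_deriv (by simp)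
  have hSC : HasDerivAt (fun s ↦ sin s * cos s) (1 - 2 * sin s ^ 2) s :=
    (hS.fun_mul hC).congr_deriv (by linear_combination Real.sin_sq_add_cos_sq s)
  have hS3C : HasDerivAt (fun s ↦ sin s ^ 3 * cos s) (3 * sin s ^ 2 - 4 * sin s ^ 4) s :=
    ((hS.fun_pow 3).fun_mul hC).congr_deriv (by
      simp only [Nat.cast_ofNat, Nat.add_one_sub_one]
      linear_combination 3 * sin s ^ 2 * Real.sin_sq_add_cos_sq s)
  have h1 := (hasDerivAt_id' s).fun_mul (hu.fun_div hden (pow_ne_zero 2 hp))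
  have h2 := (((hasDerivAt_id' s).fun_sub hSC).div_const 2).const_mul (3 + 12 * a - 3 * a ^ 2)
  have h3 := (((((hasDerivAt_id' s).const_mul 3).div_const 8).fun_sub
    ((hSC.const_mul 3).div_const 8)).fun_sub (hS3C.div_const 4)).const_mul (10 * a - 2 * a ^ 2)
  refine ((h1.fun_sub ((h2.fun_sub h3).div_const ((1 + a) ^ 4))).div_const 2).congr_deriv ?_
  field_simp
  ring

lemma kernel_le_deriv_majorant {a u : ℝ} (ha : 0 ≤ a) (ha' : a ≤ 1 / 2) (hu : 0 ≤ u) :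
    ((3 + 12 * a - 3 * a ^ 2) * u - (10 * a - 2 * a ^ 2) * u ^ 2) / (1 + a) ^ 4 ≤
      u * (3 - a * u) / (1 + a * u) ^ 3 := by
  rw [div_le_div_iff₀ (by positivity) (by positivity), ← sub_nonneg]
  have h1 : 0 ≤ 21 * a ^ 2 + 12 * a ^ 3 + 3 * a ^ 4 := by positivity
  have h2 : 0 ≤ 27 * a ^ 3 + 2 * a ^ 4 - a ^ 5 := by
    have : 0 ≤ a ^ 3 * (27 + 2 * a - a ^ 2) := mul_nonneg (by positivity) (by nlinarith)
    linarith
  have h3 : 0 ≤ a ^ 3 * (10 * a - 2 * a ^ 2) := mul_nonneg (by positivity) (by nlinarith)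
  have : 0 ≤ u * (1 - u) ^ 2 * ((21 * a ^ 2 + 12 * a ^ 3 + 3 * a ^ 4) +
      (27 * a ^ 3 + 2 * a ^ 4 - a ^ 5) * u + a ^ 3 * (10 * a - 2 * a ^ 2) * u ^ 2) := by
    positivity
  refine this.trans_eq ?_
  ring

lemma majorant_nonpos {a s : ℝ} (ha : 0 ≤ a) (ha' : a ≤ 1 / 2) (hs : Real.pi ≤ s) :
    majorant a s ≤ 0 := by
  have hs3 : 3.14 ≤ s := Real.pi_gt_d2.le.trans hs
  have hsc := Real.sin_sq_add_cos_sq s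
  have hm0 := abs_nonneg (cos s)
  have hm1 := Real.abs_cos_le_one s
  have hmsq := sq_abs (cos s)
  have hSC : sin s * cos s ≤ |cos s| := by
    refine (le_abs_self _).trans ?_
    rw [abs_mul]
    exact mul_le_of_le_one_left (abs_nonneg _) (Real.abs_sin_le_one s)
  set S := sin s
  set C := cos s
  set m := |C|
  have hu0 : 0 ≤ S ^ 2 := sq_nonneg S
  have hv : S ^ 2 / (1 + a * S ^ 2) ^ 2 ≤ (2 * a + (1 - a) * S ^ 2) / (1 + a) ^ 3 := by
    rw [div_le_div_iff₀ (by positivity) (by positivity), ← sub_nonneg]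
    have h1a : 0 ≤ 1 - a := by linarith
    have : 0 ≤ (1 - S ^ 2) ^ 2 * (2 * a + a ^ 2 * (1 - a) * S ^ 2) := by positivity
    refine this.trans_eq ?_
    ring
  have hcoef : 0 ≤ 1.5 - 0.25 * a - 0.25 * a ^ 2 + (2.5 * a - 0.5 * a ^ 2) * m ^ 2 := by
    have : 0 ≤ (2.5 * a - 0.5 * a ^ 2) * m ^ 2 := mul_nonneg (by nlinarith) (sq_nonneg m)
    nlinarith
  have hmain : S * C * (1.5 - 0.25 * a - 0.25 * a ^ 2 + (2.5 * a - 0.5 * a ^ 2) * m ^ 2) ≤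
      s * (0.5 + 0.25 * a - 1.75 * a ^ 2 + (1 - a ^ 2) * m ^ 2) := by
    have h1 := mul_le_mul_of_nonneg_right hSC hcoef
    have hD : 0 ≤ 0.5 + 0.25 * a - 1.75 * a ^ 2 + (1 - a ^ 2) * m ^ 2 := by
      have : 0 ≤ (1 - a ^ 2) * m ^ 2 := mul_nonneg (by nlinarith) (sq_nonneg m)
      nlinarith
    have h2 := mul_le_mul_of_nonneg_right hs3 hD
    have h3 : m * ((2.5 * a - 0.5 * a ^ 2) * m ^ 2) ≤ (2.5 * a - 0.5 * a ^ 2) * m ^ 2 :=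
      mul_le_of_le_one_left (mul_nonneg (by nlinarith) (sq_nonneg m)) hm1
    have h4 : 0 ≤ (3.14 * (1 - a ^ 2) - (2.5 * a - 0.5 * a ^ 2) - 1.2) * m ^ 2 :=
      mul_nonneg (by nlinarith) (sq_nonneg m)
    have h5 : 0 ≤ 3.14 * (0.5 + 0.25 * a - 1.75 * a ^ 2) - 0.58 := by nlinarith
    have h6 : 0 ≤ m * (0.25 * a + 0.25 * a ^ 2) := by positivity
    nlinarith [sq_nonneg (m - 0.625)]
  have ha1 : 0 < (1 + a) ^ 4 := by positivity
  have hs0 : 0 ≤ s := by linarith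
  have h1 := mul_le_mul_of_nonneg_left hv hs0
  have h2 : s * ((2 * a + (1 - a) * S ^ 2) / (1 + a) ^ 3) ≤
      ((3 + 12 * a - 3 * a ^ 2) * ((s - S * C) / 2) -
        (10 * a - 2 * a ^ 2) * (3 * s / 8 - 3 * (S * C) / 8 - S ^ 3 * C / 4)) / (1 + a) ^ 4 := by
    rw [le_div_iff₀ ha1]
    have e : s * ((2 * a + (1 - a) * S ^ 2) / (1 + a) ^ 3) * (1 + a) ^ 4 =
        s * ((1 + a) * (2 * a + (1 - a) * S ^ 2)) := by field_simp
    have hS2 : S ^ 2 = 1 - m ^ 2 := by linarith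
    have hS3 : S ^ 3 * C = S * C * (1 - m ^ 2) := by rw [← hS2]; ring
    rw [e, hS3, hS2]
    nlinarith
  unfold majorant
  linarith

lemma continuous_kernel_deriv {a : ℝ} (ha : -1 < a) : Continuous fun t ↦
    (1 - a * sin t ^ 2) / (1 + a * sin t ^ 2) ^ 3 * (sin t * (t * cos t - sin t)) := by
  have h (t : ℝ) := (pow_pos (one_add_mul_sin_sq_pos ha t) 3).ne'
  fun_prop (disch := exact h _)

lemma integral_kernel_deriv_nonpos {a s : ℝ} (ha : 0 ≤ a) (ha' : a ≤ 1 / 2) (hs : 0 ≤ s) :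
    ∫ t in (0 : ℝ)..s, (1 - a * sin t ^ 2) / (1 + a * sin t ^ 2) ^ 3 *
      (sin t * (t * cos t - sin t)) ≤ 0 := by
  have hcont := continuous_kernel_deriv (show -1 < a by linarith)
  rcases le_total s Real.pi with h | h
  · rw [← neg_nonneg, ← intervalIntegral.integral_neg]
    refine intervalIntegral.integral_nonneg hs fun t ht ↦ ?_
    have h1 := mul_cos_le_sin ht.1 (ht.2.trans h)
    have h2 := Real.sin_nonneg_of_nonneg_of_le_pi ht.1 (ht.2.trans h)
    have h3 : 0 ≤ 1 - a * sin t ^ 2 := by nlinarith [Real.sin_sq_le_one t, sq_nonneg (sin t)]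
    have h4 := one_add_mul_sin_sq_pos (show -1 < a by linarith) t
    rw [← mul_neg, ← mul_neg, neg_sub]
    have h5 := sub_nonneg.2 h1
    positivity
  · refine le_trans ?_ (majorant_nonpos ha ha' h)
    have hd := majorant_hasDerivAt ha
    have h0 : majorant a 0 = 0 := by simp [majorant]
    have e : majorant a s = majorant a s - majorant a 0 := by rw [h0, sub_zero]
    rw [e]
    refine intervalIntegral.integral_le_sub_of_hasDeriv_right_of_le hs
      (fun x _ ↦ (hd x).continuousAt.continuousWithinAt)
      (fun x _ ↦ (hd x).hasDerivWithinAt) (hcont.integrableOn_Icc) fun x _ ↦ ?_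
    have := kernel_le_deriv_majorant ha ha' (sq_nonneg (sin x))
    rw [← pow_mul] at this
    norm_num at this
    linarith

/-- The integral whose monotonicity in `c` drives the comparison of Prüfer angles. -/
noncomputable def kernelIntegral (c s : ℝ) : ℝ :=
  ∫ t in (0 : ℝ)..s, c / (1 + c * sin t ^ 2) ^ 2 * (sin t * (t * cos t - sin t))

lemma continuous_kernel {c : ℝ} (hc : -1 < c) : Continuous fun t ↦
    c / (1 + c * sin t ^ 2) ^ 2 * (sin t * (t * cos t - sin t)) := by
  have h (t : ℝ) := (pow_pos (one_add_mul_sin_sq_pos hc t) 2).ne'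
  fun_prop (disch := exact h _)

lemma kernelIntegral_hasDerivAt_right {c : ℝ} (hc : 0 ≤ c) (s : ℝ) :
    HasDerivAt (kernelIntegral c)
      (c / (1 + c * sin s ^ 2) ^ 2 * (sin s * (s * cos s - sin s))) s :=
  ((continuous_kernel (by linarith)).integral_hasStrictDerivAt 0 s).hasDerivAt

lemma kernelIntegral_hasDerivAt_left {c : ℝ} (hc : c ∈ Icc (0 : ℝ) (1 / 2)) (s : ℝ) :
    HasDerivAt (fun c ↦ kernelIntegral c s)
      (∫ t in (0 : ℝ)..s, (1 - c * sin t ^ 2) / (1 + c * sin t ^ 2) ^ 3 *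
        (sin t * (t * cos t - sin t))) c := by
  have hmem : Ioo (-(1 / 2) : ℝ) 1 ∈ 𝓝 c :=
    Ioo_mem_nhds (by linarith [hc.1]) (by linarith [hc.2])
  refine (intervalIntegral.hasDerivAt_integral_of_dominated_loc_of_deriv_le
    (F' := fun c t ↦ (1 - c * sin t ^ 2) / (1 + c * sin t ^ 2) ^ 3 *
      (sin t * (t * cos t - sin t)))
    (bound := fun t ↦ 16 * |sin t * (t * cos t - sin t)|) hmem ?_
    ((continuous_kernel (by linarith [hc.1])).intervalIntegrable _ _)
    (continuous_kernel_deriv (by linarith [hc.1])).aestronglyMeasurable ?_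
    (Continuous.intervalIntegrable (by fun_prop) _ _) ?_).2
  · filter_upwards [hmem] with x hx
    exact (continuous_kernel (by linarith [hx.1])).aestronglyMeasurable
  · refine .of_forall fun t _ x hx ↦ ?_
    have h1 := Real.sin_sq_le_one t
    have h2 := sq_nonneg (sin t)
    have h3 : 1 / 2 ≤ 1 + x * sin t ^ 2 := by nlinarith [hx.1]
    have h4 : |1 - x * sin t ^ 2| ≤ 2 := by
      rw [abs_le]; constructor <;> nlinarith [hx.1, hx.2]
    have h5 : (1 / 2 : ℝ) ^ 3 ≤ (1 + x * sin t ^ 2) ^ 3 := pow_le_pow_left₀ (by norm_num) h3 3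
    rw [Real.norm_eq_abs, abs_mul, abs_div]
    refine mul_le_mul_of_nonneg_right ?_ (abs_nonneg _)
    rw [abs_of_pos (by linarith : 0 < (1 + x * sin t ^ 2) ^ 3), div_le_iff₀ (by linarith)]
    linarith
  · refine .of_forall fun t _ x hx ↦ ?_
    have hp := (one_add_mul_sin_sq_pos (show -1 < x by linarith [hx.1]) t).ne'
    have hden : HasDerivAt (fun x ↦ (1 + x * sin t ^ 2) ^ 2)
        (2 * (1 + x * sin t ^ 2) * sin t ^ 2) x :=
      ((((hasDerivAt_id' x).mul_const (sin t ^ 2)).const_add 1).fun_pow 2).congr_deriv (by simp)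
    refine (((hasDerivAt_id' x).fun_div hden (pow_ne_zero 2 hp)).mul_const _).congr_deriv ?_
    congr 1
    field_simp
    ring

lemma kernelIntegral_antitoneOn {s : ℝ} (hs : 0 ≤ s) :
    AntitoneOn (fun c ↦ kernelIntegral c s) (Icc 0 (1 / 2)) := by
  refine antitoneOn_of_deriv_nonpos (convex_Icc _ _)
    (fun c hc ↦ (kernelIntegral_hasDerivAt_left hc s).continuousAt.continuousWithinAt)
    (fun c hc ↦ (kernelIntegral_hasDerivAt_left
      (interior_subset hc) s).differentiableAt.differentiableWithinAt) fun c hc ↦ ?_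
  have hc' := interior_subset hc
  rw [(kernelIntegral_hasDerivAt_left hc' s).deriv]
  exact integral_kernel_deriv_nonpos hc'.1 hc'.2 hs

lemma kernelIntegral_nonpos {c s : ℝ} (hc : c ∈ Icc (0 : ℝ) (1 / 2)) (hs : 0 ≤ s) :
    kernelIntegral c s ≤ 0 := by
  have := kernelIntegral_antitoneOn hs (left_mem_Icc.2 (by norm_num)) hc hc.1
  simpa [kernelIntegral] using this

lemma monotoneOn_energy {u s : ℝ} (hs : 0 ≤ s) :
    MonotoneOn (fun c ↦ (1 + c * u ^ 2) * -kernelIntegral c s) (Icc 0 (1 / 2)) := by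
  intro c hc d hd hcd
  have h1 := kernelIntegral_antitoneOn hs hc hd hcd
  have h2 := kernelIntegral_nonpos hc hs
  have h3 := mul_le_mul_of_nonneg_right hcd (sq_nonneg u)
  refine mul_le_mul (by linarith) (neg_le_neg h1) (by linarith) ?_
  have := hd.1
  positivity

/-- For an antitone potential, the derivative of the Prüfer angle in `z` is at most its mean
slope. -/
lemma IsAngle.mul_integral_le {Q φ : ℝ → ℝ} {z X : ℝ} (hQ : Continuous Q)
    (hQ0 : ∀ x, 0 ≤ Q x) (hX : X ∈ Icc (0 : ℝ) 1) (hanti : AntitoneOn Q (Icc 0 X))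
    (hz : 0 < z) (hQz : ∀ x, 2 * Q x ≤ z ^ 2) (h : IsAngle z (fun x ↦ Q x / z) φ) :
    z * ∫ x in (0 : ℝ)..X, exp (-∫ t in (0 : ℝ)..x, Q t / z * sin (φ t + φ t)) *
        (1 - Q x / z ^ 2 * sin (φ x) ^ 2) ≤
      exp (-∫ t in (0 : ℝ)..X, Q t / z * sin (φ t + φ t)) * φ X := by
  have hφc := h.cont
  have hβ : Continuous fun x ↦ Q x / z := by fun_prop
  have hA : Continuous fun t ↦ Q t / z * sin (φ t + φ t) := by fun_prop
  set ρ : ℝ → ℝ := fun x ↦ exp (-∫ t in (0 : ℝ)..x, Q t / z * sin (φ t + φ t)) with hρ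
  have hρ' (x : ℝ) : HasDerivAt ρ (-(Q x / z * sin (φ x + φ x)) * ρ x) x :=
    (hA.integral_hasStrictDerivAt 0 x).hasDerivAt.fun_neg.exp.congr_deriv (mul_comm _ _)
  have hρ0 (x : ℝ) : 0 < ρ x := Real.exp_pos _
  have hρc : Continuous ρ := continuous_iff_continuousAt.2 fun x ↦ (hρ' x).continuousAt
  set c : ℝ → ℝ := fun x ↦ Q x / z ^ 2 with hc
  have hcc : Continuous c := by fun_prop
  have hcm (x : ℝ) : c x ∈ Icc (0 : ℝ) (1 / 2) :=
    ⟨div_nonneg (hQ0 x) (sq_nonneg z), by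
      rw [hc]; simp only; rw [div_le_iff₀ (by positivity)]; linarith [hQz x]⟩
  have hcz (x : ℝ) : Q x / z = z * c x := by simp only [hc]; field_simp
  have hN : Continuous fun x ↦ ρ x * (1 - c x * sin (φ x) ^ 2) := by fun_prop
  set I : ℝ → ℝ := fun x ↦ z * (∫ t in (0 : ℝ)..x, ρ t * (1 - c t * sin (φ t) ^ 2)) - ρ x * φ x
    with hI
  have hI' : ∀ x ∈ Icc (0 : ℝ) 1, HasDerivAt I
      (2 * z * ρ x * c x * (sin (φ x) * (φ x * cos (φ x) - sin (φ x)))) x := fun x hx ↦ by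
    refine (((hN.integral_hasStrictDerivAt 0 x).hasDerivAt.const_mul z).fun_sub
      ((hρ' x).fun_mul (h.deriv x hx))).congr_deriv ?_
    rw [hcz, Real.sin_add]
    ring
  set V : ℝ → ℝ → ℝ := fun k x ↦
    I x + 2 * ρ x * ((1 + k * sin (φ x) ^ 2) * -kernelIntegral k (φ x)) with hV
  have hV' : ∀ x ∈ Icc (0 : ℝ) 1, HasDerivAt (V (c x)) 0 x := fun x hx ↦ by
    have hp := (one_add_mul_sin_sq_pos (show -1 < c x by linarith [(hcm x).1]) (φ x)).ne'
    have h1 := ((((h.deriv x hx).sin.fun_pow 2).const_mul (c x)).const_add 1).fun_mul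
      ((kernelIntegral_hasDerivAt_right (hcm x).1 (φ x)).comp x (h.deriv x hx)).fun_neg
    refine ((hI' x hx).fun_add (((hρ' x).const_mul 2).fun_mul h1)).congr_deriv ?_
    simp only [Function.comp_apply, Nat.cast_ofNat, Nat.add_one_sub_one, pow_one]
    rw [hcz, Real.sin_add]
    field_simp
    ring
  have hK : Continuous fun x ↦ kernelIntegral (c x) (φ x) := by
    refine intervalIntegral.continuous_parametric_intervalIntegral_of_continuous
      (f := fun x t ↦ c x / (1 + c x * sin t ^ 2) ^ 2 * (sin t * (t * cos t - sin t))) ?_ hφc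
    have hp (p : ℝ × ℝ) := (pow_pos (one_add_mul_sin_sq_pos
      (show -1 < c p.1 by linarith [(hcm p.1).1]) p.2) 2).ne'
    simp only [Function.uncurry_def]
    fun_prop (disch := exact hp _)
  have hfc : ContinuousOn (fun x ↦ V (c x) x) (Icc 0 X) := by
    have hIc : ContinuousOn I (Icc 0 X) := fun x hx ↦
      (hI' x ⟨hx.1, hx.2.trans hX.2⟩).continuousAt.continuousWithinAt
    exact hIc.add (Continuous.continuousOn (by fun_prop))
  have hf0 : V (c 0) 0 = 0 := by simp [hV, hI, h.zero, kernelIntegral]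
  have hslope : ∀ x ∈ Ico 0 X, ∀ r, (0 : ℝ) < r →
      ∃ᶠ y in 𝓝[>] x, slope (fun x ↦ V (c x) x) x y < r := fun x hx r hr ↦ by
    have hx1 : x ∈ Icc (0 : ℝ) 1 := ⟨hx.1, hx.2.le.trans hX.2⟩
    have ht := (hasDerivAt_iff_tendsto_slope.1 (hV' x hx1)).mono_left
      (nhdsWithin_mono x fun y (hy : x < y) ↦ hy.ne')
    have hmem : ∀ᶠ y in 𝓝[>] x, y ∈ Ioo x X := Ioo_mem_nhdsGT hx.2
    refine Eventually.frequently ?_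
    filter_upwards [ht.eventually (gt_mem_nhds hr), hmem] with y hy hyX
    refine lt_of_le_of_lt ?_ hy
    rw [slope_def_field, slope_def_field]
    refine div_le_div_of_nonneg_right (sub_le_sub_right ?_ _) (sub_nonneg.2 hyX.1.le)
    have hy0 : 0 ≤ y := hx.1.trans hyX.1.le
    have hcyx : c y ≤ c x := div_le_div_of_nonneg_right
      (hanti ⟨hx.1, hx.2.le⟩ ⟨hy0, hyX.2.le⟩ hyX.1.le) (sq_nonneg z)
    have hφy := h.nonneg hβ hz (x := y) ⟨hy0, hyX.2.le.trans hX.2⟩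
    have := monotoneOn_energy (u := sin (φ y)) hφy (hcm y) (hcm x) hcyx
    have := mul_le_mul_of_nonneg_left this (mul_nonneg zero_le_two (hρ0 y).le)
    simp only [hV]
    linarith
  have hfX : V (c X) X ≤ 0 := by
    refine le_of_forall_pos_le_add fun ε hε ↦ ?_
    have := image_le_of_liminf_slope_right_lt_deriv_boundary (f' := fun _ ↦ 0)
      (B := fun x ↦ ε * x) (B' := fun _ ↦ ε) hfc hslope (by rw [hf0, mul_zero])
      (fun x ↦ by simpa using (hasDerivAt_id' x).const_mul ε) (fun _ _ _ ↦ hε)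
      (right_mem_Icc.2 hX.1)
    refine this.trans ?_
    rw [zero_add]
    exact mul_le_of_le_one_right hε.le hX.2
  have hφX := h.nonneg hβ hz hX
  have h1 : 0 ≤ 2 * ρ X * ((1 + c X * sin (φ X) ^ 2) * -kernelIntegral (c X) (φ X)) := by
    have h2 := neg_nonneg.2 (kernelIntegral_nonpos (hcm X) hφX)
    have h3 := (hcm X).1
    have h4 := (hρ0 X).le
    positivity
  have h2 : I X ≤ 0 := by
    simp only [hV] at hfX
    linarith
  exact sub_nonpos.1 h2

lemma tendsto_integral_of_abs_le {F : ℝ → ℝ → ℝ} {p₀ C x : ℝ} (hF : ∀ p, Continuous (F p))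
    (hC : ∀ᶠ p in 𝓝 p₀, ∀ t ∈ Icc (0 : ℝ) 1, |F p t| ≤ C)
    (hlim : ∀ t ∈ Icc (0 : ℝ) 1, Tendsto (fun p ↦ F p t) (𝓝 p₀) (𝓝 (F p₀ t)))
    (hx : x ∈ Icc (0 : ℝ) 1) :
    Tendsto (fun p ↦ ∫ t in (0 : ℝ)..x, F p t) (𝓝 p₀) (𝓝 (∫ t in (0 : ℝ)..x, F p₀ t)) := by
  have hmem {t : ℝ} (ht : t ∈ uIoc 0 x) : t ∈ Icc (0 : ℝ) 1 := by
    rw [uIoc_of_le hx.1] at ht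
    exact ⟨ht.1.le, ht.2.trans hx.2⟩
  refine intervalIntegral.tendsto_integral_filter_of_dominated_convergence (fun _ ↦ C)
    (.of_forall fun p ↦ (hF p).aestronglyMeasurable) ?_ intervalIntegrable_const
    (.of_forall fun t ht ↦ hlim t (hmem ht))
  filter_upwards [hC] with p hp
  exact .of_forall fun t ht ↦ hp t (hmem ht)

/-- The derivative of the Prüfer angle with respect to `z`. -/
lemma hasDerivAt_isAngle {Q : ℝ → ℝ} {φ : ℝ → ℝ → ℝ} {z X : ℝ} (hQ : Continuous Q)
    (hX : X ∈ Icc (0 : ℝ) 1) (hz : 0 < z) (h : ∀ p, IsAngle p (fun x ↦ Q x / p) (φ p)) :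
    HasDerivAt (fun p ↦ φ p X)
      (exp (∫ t in (0 : ℝ)..X, Q t / z * sin (φ z t + φ z t)) *
        ∫ x in (0 : ℝ)..X, exp (-∫ t in (0 : ℝ)..x, Q t / z * sin (φ z t + φ z t)) *
          (1 - Q x / z ^ 2 * sin (φ z x) ^ 2)) z := by
  have hφc (p : ℝ) := (h p).cont
  have hsinc := Real.continuous_sinc
  have hz0 := hz.ne'
  obtain ⟨C, hC⟩ := isCompact_Icc.exists_bound_of_continuousOn (s := Icc (0 : ℝ) 1)
    (f := Q) hQ.continuousOn
  simp only [Real.norm_eq_abs] at hC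
  have hC0 : 0 ≤ C := (abs_nonneg _).trans (hC 0 (by simp))
  have hφt : ∀ t ∈ Icc (0 : ℝ) 1, ContinuousAt (fun p ↦ φ p t) z := fun t ht ↦ by
    refine continuousAt_isAngle (z := fun p ↦ p) (.of_forall h)
      (.of_forall fun p ↦ by fun_prop) continuousAt_id (fun ε hε ↦ ?_) ht
    have hlim : Tendsto (fun p ↦ C * |p⁻¹ - z⁻¹|) (𝓝 z) (𝓝 0) := by
      have : ContinuousAt (fun p : ℝ ↦ C * |p⁻¹ - z⁻¹|) z := by
        fun_prop (disch := assumption)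
      simpa [ContinuousAt] using this
    filter_upwards [hlim.eventually (gt_mem_nhds hε)] with p hp x hx
    rw [div_eq_mul_inv, div_eq_mul_inv, ← mul_sub, abs_mul]
    exact (mul_le_mul_of_nonneg_right (hC x hx) (abs_nonneg _)).trans hp.le
  set A : ℝ → ℝ → ℝ := fun p t ↦
    Q t / z * sin (φ p t + φ z t) * sinc (φ p t - φ z t) with hA
  have hAc (p : ℝ) : Continuous (A p) := by fun_prop
  have hAz : A z = fun t ↦ Q t / z * sin (φ z t + φ z t) := by simp [hA]
  have hAC (p : ℝ) : ∀ t ∈ Icc (0 : ℝ) 1, |A p t| ≤ C / z := fun t ht ↦ by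
    rw [hA]; simp only
    rw [abs_mul, abs_mul, abs_div, abs_of_pos hz]
    refine (mul_le_of_le_one_right (by positivity) (Real.abs_sinc_le_one _)).trans ?_
    refine (mul_le_of_le_one_right (by positivity) (Real.abs_sin_le_one _)).trans ?_
    exact div_le_div_of_nonneg_right (hC t ht) hz.le
  have hAlim : ∀ t ∈ Icc (0 : ℝ) 1, Tendsto (fun p ↦ A p t) (𝓝 z) (𝓝 (A z t)) := fun t ht ↦ by
    have := hφt t ht
    exact show ContinuousAt (fun p ↦ A p t) z by fun_prop
  have hIA : ∀ x ∈ Icc (0 : ℝ) 1, Tendsto (fun p ↦ ∫ t in (0 : ℝ)..x, A p t) (𝓝 z)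
      (𝓝 (∫ t in (0 : ℝ)..x, A z t)) := fun x hx ↦
    tendsto_integral_of_abs_le hAc (.of_forall hAC) hAlim hx
  set D : ℝ → ℝ → ℝ := fun p x ↦
    exp (-∫ t in (0 : ℝ)..x, A p t) * (1 - Q x / (p * z) * sin (φ p x) ^ 2) with hD
  have hDc (p : ℝ) : Continuous (D p) := by
    have : Continuous fun x ↦ ∫ t in (0 : ℝ)..x, A p t :=
      intervalIntegral.continuous_primitive (fun a b ↦ (hAc p).intervalIntegrable a b) 0
    fun_prop
  have hDlim : ∀ x ∈ Icc (0 : ℝ) 1, Tendsto (fun p ↦ D p x) (𝓝 z) (𝓝 (D z x)) := fun x hx ↦ by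
    have h1 := hφt x hx
    have h2 : ContinuousAt (fun p ↦ ∫ t in (0 : ℝ)..x, A p t) z := hIA x hx
    have h3 : z * z ≠ 0 := mul_ne_zero hz0 hz0
    exact show ContinuousAt (fun p ↦ D p x) z by fun_prop (disch := assumption)
  have hDC : ∀ᶠ p in 𝓝 z, ∀ x ∈ Icc (0 : ℝ) 1,
      |D p x| ≤ exp (C / z) * (1 + C / (z / 2 * z)) := by
    filter_upwards [lt_mem_nhds (half_lt_self hz)] with p hp x hx
    have hp0 : 0 < p := by linarith
    rw [hD]; simp only
    rw [abs_mul, Real.abs_exp]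
    refine mul_le_mul (Real.exp_le_exp.2 ?_) ?_ (abs_nonneg _) (Real.exp_nonneg _)
    · exact (neg_le_abs _).trans (abs_integral_le (hAC p) hx)
    · refine (abs_sub _ _).trans ?_
      rw [abs_one, abs_mul, abs_div, abs_of_pos (by positivity : 0 < p * z),
        abs_of_nonneg (sq_nonneg (sin (φ p x)))]
      refine add_le_add le_rfl ?_
      refine (mul_le_of_le_one_right (by positivity) (Real.sin_sq_le_one _)).trans ?_
      exact div_le_div₀ hC0 (hC x hx) (by positivity)
        (mul_le_mul_of_nonneg_right hp.le hz.le)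
  have hG : Tendsto (fun p ↦ exp (∫ t in (0 : ℝ)..X, A p t) * ∫ x in (0 : ℝ)..X, D p x) (𝓝 z)
      (𝓝 (exp (∫ t in (0 : ℝ)..X, A z t) * ∫ x in (0 : ℝ)..X, D z x)) :=
    ((Real.continuous_exp.tendsto _).comp (hIA X hX)).mul
      (tendsto_integral_of_abs_le hDc hDC hDlim hX)
  rw [hasDerivAt_iff_tendsto_slope]
  simp only [hD, hAz, ← pow_two] at hG
  refine (hG.mono_left nhdsWithin_le_nhds).congr' ?_
  filter_upwards [self_mem_nhdsWithin, nhdsWithin_le_nhds (lt_mem_nhds hz)] with p hpz hp0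
  have hp := hp0.ne'
  have hpz' : p - z ≠ 0 := sub_ne_zero.2 hpz
  have e := linear_eq_exp_mul (w := fun x ↦ φ p x - φ z x) (hAc p)
    (B := fun x ↦ (p - z) + (Q x / p - Q x / z) * sin (φ p x) ^ 2) (by fun_prop)
    (fun x hx ↦ (h z).hasDerivAt_sub (h p) hx) hX
  simp only [(h p).zero, (h z).zero, sub_self, zero_add] at e
  rw [slope_def_field, e, eq_div_iff hpz', mul_assoc, mul_comm _ (p - z),
    ← intervalIntegral.integral_const_mul]
  congr 2
  ext x
  field_simp
  ring

/-- For an antitone potential, `φ_z(X) / z` decreases in `z`. -/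
lemma isAngle_div_le {Q φ₁ φ₂ : ℝ → ℝ} {z₁ z₂ X : ℝ} (hQ : Continuous Q)
    (hQ0 : ∀ x, 0 ≤ Q x) (hX : X ∈ Icc (0 : ℝ) 1) (hanti : AntitoneOn Q (Icc 0 X))
    (hz₁ : 0 < z₁) (hz : z₁ ≤ z₂) (hQz : ∀ x, 2 * Q x ≤ z₁ ^ 2)
    (h₁ : IsAngle z₁ (fun x ↦ Q x / z₁) φ₁) (h₂ : IsAngle z₂ (fun x ↦ Q x / z₂) φ₂) :
    φ₂ X / z₂ ≤ φ₁ X / z₁ := by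
  have hβ (p : ℝ) : Continuous fun x ↦ Q x / p := by fun_prop
  choose φ h using fun p : ℝ ↦ exists_isAngle p (hβ p)
  rw [h₁.eqOn (hβ _) (h _) hX, h₂.eqOn (hβ _) (h _) hX]
  have hd : ∀ z ∈ Ici z₁, HasDerivAt (fun p ↦ φ p X / p) _ z := fun z hz ↦
    (hasDerivAt_isAngle hQ hX (hz₁.trans_le hz) h).fun_div (hasDerivAt_id' z)
      (hz₁.trans_le hz).ne'
  refine antitoneOn_of_deriv_nonpos (f := fun p ↦ φ p X / p) (convex_Ici z₁)
    (fun z hz ↦ (hd z hz).continuousAt.continuousWithinAt)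
    (fun z hz ↦ (hd z (interior_subset hz)).differentiableAt.differentiableWithinAt)
    (fun z hz ↦ ?_) self_mem_Ici hz hz
  have hz' : z₁ ≤ z := interior_subset hz
  rw [(hd z hz').deriv]
  refine div_nonpos_of_nonpos_of_nonneg ?_ (sq_nonneg z)
  have hG := (h z).mul_integral_le hQ hQ0 hX hanti (hz₁.trans_le hz')
    fun x ↦ (hQz x).trans (pow_le_pow_left₀ hz₁.le hz' 2)
  rw [Real.exp_neg, inv_mul_eq_div, le_div_iff₀ (Real.exp_pos _)] at hG
  linarith

/-- Reflecting the interval turns a Prüfer angle ending at `k π` into a Prüfer angle. -/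
lemma IsAngle.reflect {z : ℝ} {β φ : ℝ → ℝ} {k : ℕ} (h : IsAngle z β φ)
    (h1 : φ 1 = k * Real.pi) :
    IsAngle z (fun x ↦ β (1 - x)) (fun x ↦ k * Real.pi - φ (1 - x)) := by
  have hc := h.cont
  refine ⟨by fun_prop, by simp [h1], fun x hx ↦ ?_⟩
  have hx' : 1 - x ∈ Icc (0 : ℝ) 1 := ⟨by linarith [hx.2], by linarith [hx.1]⟩
  refine (((h.deriv _ hx').comp x ((hasDerivAt_id' x).const_sub 1)).const_sub
    (k * Real.pi)).congr_deriv ?_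
  rw [Real.sin_nat_mul_pi_sub, neg_sq, mul_pow, ← pow_mul, mul_comm k 2, pow_mul]
  norm_num

/-- If `Q` is antitone on `[0, x₀]` and monotone on `[x₀, 1]`, angles ending at `m π` and `n π`
satisfy `n / z₂ ≤ m / z₁`. -/
lemma natCast_div_le_of_isAngle {Q φ₁ φ₂ : ℝ → ℝ} {z₁ z₂ x₀ : ℝ} {m n : ℕ}
    (hQ : Continuous Q) (hQ0 : ∀ x, 0 ≤ Q x) (hx₀ : x₀ ∈ Icc (0 : ℝ) 1)
    (hanti : AntitoneOn Q (Icc 0 x₀)) (hmono : MonotoneOn Q (Icc x₀ 1))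
    (hz₁ : 0 < z₁) (hz : z₁ ≤ z₂) (hQz : ∀ x, 2 * Q x ≤ z₁ ^ 2)
    (h₁ : IsAngle z₁ (fun x ↦ Q x / z₁) φ₁) (h₂ : IsAngle z₂ (fun x ↦ Q x / z₂) φ₂)
    (hm : φ₁ 1 = m * Real.pi) (hn : φ₂ 1 = n * Real.pi) : n / z₂ ≤ m / z₁ := by
  have hl := isAngle_div_le hQ hQ0 hx₀ hanti hz₁ hz hQz h₁ h₂
  have hr := isAngle_div_le (Q := fun x ↦ Q (1 - x)) (X := 1 - x₀) (by fun_prop)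
    (fun x ↦ hQ0 _) ⟨by linarith [hx₀.2], by linarith [hx₀.1]⟩
    (fun x hx y hy hxy ↦ hmono ⟨by linarith [hy.2], by linarith [hy.1]⟩
      ⟨by linarith [hx.2], by linarith [hx.1]⟩ (by linarith))
    hz₁ hz (fun x ↦ hQz _) (h₁.reflect hm) (h₂.reflect hn)
  simp only [sub_sub_cancel, sub_div] at hr
  refine le_of_mul_le_mul_right ?_ Real.pi_pos
  rw [div_mul_eq_mul_div, div_mul_eq_mul_div]
  linarith

lemma isDirichletEigenvalue_congr {q r : ℝ → ℝ} {lam : ℝ}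
    (h : ∀ x ∈ Icc (0 : ℝ) 1, q x = r x) :
    IsDirichletEigenvalue q 0 1 lam ↔ IsDirichletEigenvalue r 0 1 lam := by
  simp +contextual only [IsDirichletEigenvalue, h]

/-- The ratio bound for a continuous potential on the whole line. -/
lemma ratio_lower_bound {q : ℝ → ℝ} {x₀ c : ℝ} (hq : Continuous q) (hx₀ : x₀ ∈ Icc (0 : ℝ) 1)
    (hq_nonpos : ∀ x, q x ≤ 0) (hc : ∀ x, c ≤ q x) (hq_inc : MonotoneOn q (Icc 0 x₀))
    (hq_dec : AntitoneOn q (Icc x₀ 1)) {μ : ℕ+ → ℝ} (hμ_mono : StrictMono μ)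
    (hμ_eig : ∀ n : ℕ+, IsDirichletEigenvalue q 0 1 (μ n))
    (hμ_all : ∀ lam : ℝ, IsDirichletEigenvalue q 0 1 lam → ∃ n : ℕ+, μ n = lam) {n m : ℕ+}
    (hmn : μ m < μ n) (hcm : -2 * c ≤ μ m) : (n : ℝ) ^ 2 / (m : ℝ) ^ 2 ≤ μ n / μ m := by
  choose θ hθ using fun lam : ℝ ↦ exists_isAngle 1
    (show Continuous fun x ↦ (lam - q x) / 1 - 1 by fun_prop)
  have hend := isAngle_eigenvalue_eq hq hc hθ hμ_mono hμ_eig hμ_all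
  have hm0 : 0 < μ m := by
    have := (hend m).2
    rcases le_or_gt 0 c with h | h <;> linarith
  have hφ (k : ℕ+) (hk : 0 < μ k) :
      ∃ φ, IsAngle √(μ k) (fun x ↦ -q x / √(μ k)) φ ∧ φ 1 = (k : ℕ) * Real.pi := by
    have hs := Real.sqrt_pos.2 hk
    have hβ : (fun x ↦ -q x / √(μ k)) = fun x ↦ (μ k - q x) / √(μ k) - √(μ k) := by
      ext x
      rw [eq_sub_iff_add_eq, div_add' _ _ _ hs.ne', Real.mul_self_sqrt hk.le]
      congr 1
      ring
    rw [hβ]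
    obtain ⟨φ, h⟩ := exists_isAngle √(μ k)
      (show Continuous fun x ↦ (μ k - q x) / √(μ k) - √(μ k) by fun_prop)
    exact ⟨φ, h, (isAngle_eq_of_isDirichletEigenvalue hq hs h (hθ _) (hμ_eig k)).trans
      (hend k).1⟩
  obtain ⟨φ₁, h₁, hm⟩ := hφ m hm0
  obtain ⟨φ₂, h₂, hn⟩ := hφ n (hm0.trans hmn)
  have hs := Real.sqrt_pos.2 hm0
  have hs' := Real.sqrt_pos.2 (hm0.trans hmn)
  have key := natCast_div_le_of_isAngle (Q := fun x ↦ -q x) (by fun_prop)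
    (fun x ↦ neg_nonneg.2 (hq_nonpos x)) hx₀ hq_inc.neg hq_dec.neg hs
    (Real.sqrt_le_sqrt hmn.le) (fun x ↦ by rw [Real.sq_sqrt hm0.le]; linarith [hc x])
    h₁ h₂ hm hn
  have hmR : (0 : ℝ) < m := by exact_mod_cast m.pos
  rw [div_le_div_iff₀ hs' hs] at key
  have := pow_le_pow_left₀ (by positivity) key 2
  rw [mul_pow, mul_pow, Real.sq_sqrt hm0.le, Real.sq_sqrt (hm0.trans hmn).le] at this
  rw [div_le_div_iff₀ (by positivity) hm0]
  linarith

end Prufer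

/-!
**Statement 2.**  Let `q : [0,1] → ℝ` be continuous, nonpositive and single-barrier
(increasing on `[0,x₀]`, decreasing on `[x₀,1]`), and set `q₋ = min {q x : x ∈ [0,1]}`.
Let `λ₁ < λ₂ < ⋯` enumerate the eigenvalues of the Dirichlet problem
`−y'' + q y = λ y` on `[0,1]`, `y 0 = y 1 = 0`.  Then for any indices `n, m` with
`λ_n > λ_m ≥ −2 q₋`, one has `λ_n / λ_m ≥ n² / m²`.
-/
theorem dirichlet_eigenvalue_ratio_lower_bound
    (q : ℝ → ℝ) (x₀ : ℝ) (hx₀ : x₀ ∈ Set.Icc (0 : ℝ) 1)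
    (hq_cont : ContinuousOn q (Set.Icc 0 1))
    (hq_nonpos : ∀ x ∈ Set.Icc (0 : ℝ) 1, q x ≤ 0)
    (hq_inc : MonotoneOn q (Set.Icc 0 x₀))
    (hq_dec : AntitoneOn q (Set.Icc x₀ 1))
    (qmin : ℝ) (hqmin : IsLeast (q '' Set.Icc 0 1) qmin)
    -- `μ n` is the `n`-th Dirichlet eigenvalue: `μ` is the strictly increasing
    -- enumeration of the whole spectrum
    (μ : ℕ+ → ℝ) (hμ_mono : StrictMono μ)
    (hμ_eig : ∀ n : ℕ+, IsDirichletEigenvalue q 0 1 (μ n))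
    (hμ_all : ∀ lam : ℝ, IsDirichletEigenvalue q 0 1 lam → ∃ n : ℕ+, μ n = lam) :
    ∀ n m : ℕ+, μ m < μ n → -2 * qmin ≤ μ m →
      (n : ℝ) ^ 2 / (m : ℝ) ^ 2 ≤ μ n / μ m := by
  have hI : (0 : ℝ) ≤ 1 := zero_le_one
  set r : ℝ → ℝ := Set.IccExtend hI ((Set.Icc 0 1).domRestrict q)
  have hrq : ∀ x ∈ Set.Icc (0 : ℝ) 1, q x = r x := fun x hx ↦
    (Set.IccExtend_of_mem hI ((Set.Icc 0 1).domRestrict q) hx).symm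
  have hcongr (lam : ℝ) := Prufer.isDirichletEigenvalue_congr (lam := lam) hrq
  have hl : Set.Icc 0 x₀ ⊆ Set.Icc 0 1 := Set.Icc_subset_Icc_right hx₀.2
  have hr' : Set.Icc x₀ 1 ⊆ Set.Icc 0 1 := Set.Icc_subset_Icc_left hx₀.1
  intro n m hmn hm
  refine Prufer.ratio_lower_bound (q := r)
    (continuousOn_iff_continuous_domRestrict.1 hq_cont).Icc_extend' hx₀
    (fun x ↦ hq_nonpos _ (Set.projIcc 0 1 hI x).2)
    (fun x ↦ hqmin.2 (Set.mem_image_of_mem q (Set.projIcc 0 1 hI x).2))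
    (hq_inc.congr fun x hx ↦ hrq x (hl hx)) (hq_dec.congr fun x hx ↦ hrq x (hr' hx))
    hμ_mono (fun k ↦ (hcongr _).1 (hμ_eig k)) (fun lam h ↦ hμ_all lam ((hcongr lam).2 h)) hmn hm
end
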